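/- Fix ρ ∈ (0,1), ι ∈ (0,1/2), and M, Δ > 0. Let Γ be a Borel probability measure on ℝ^d that is sub-exponential and such that Γ_ρ is spread out, and let g: ℝ^d × ℝ^d → [ι, 1−ι] be a measurable allocation function satisfying the (M,Δ)-negative feedback condition. Then P_g has a unique invariant probability measure π_g, and there exist λ₁ > 0 and a constant L > 1 (uniform over all such g for the given M, Δ, Γ) such that for every measurable f: ℝ^d → ℝ with ∫ |f| dΓ < ∞, setting h(Λ) := ∫ (g(Λ,X) − ρ)·f(X) dΓ(X), one has for every n ≥ 1 and every Λ ∈ ℝ^d: | Σ_{i=1}^n (P_g^{i−1} h)(Λ) − n·∫ h dπ_g | ≤ L²·(∫ |f| dΓ)·exp(λ₁‖Λ‖). (Here Σ_{i=1}^n (P_g^{i−1} h)(Λ) equals the expected shift E[Σ_{i=1}^n (T_i − ρ)Y_i | Λ_0 = Λ] of the Markov chain with kernel P_g when f is the conditional mean of the additional covariate Y given X; thus the average shift converges to ∫ h dπ_g at rate O(1/n).) -/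

import Mathlib

open MeasureTheory ProbabilityTheory Filter Set
open scoped ENNReal RealInnerProductSpace

noncomputable section

/-- `ℝ^d` with the Euclidean norm. -/
abbrev Ed (d : ℕ) : Type := EuclideanSpace ℝ (Fin d)

/-- Action of the CAR transition kernel `P_g` on a function `h`:
`(P_g h)(Λ) = ∫ [ g(Λ,X)·h(Λ + (1−ρ)X) + (1−g(Λ,X))·h(Λ − ρX) ] dΓ(X)`. -/
def kernelOp (d : ℕ) (ρ : ℝ) (Γ : Measure (Ed d)) (g : Ed d → Ed d → ℝ)
    (h : Ed d → ℝ) (Λ : Ed d) : ℝ :=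
  ∫ X, g Λ X * h (Λ + (1 - ρ) • X) + (1 - g Λ X) * h (Λ - ρ • X) ∂Γ

/-- `W_Γ`: the linear span of the topological support of `Γ` (the set of points all of
whose open neighbourhoods have positive measure). -/
def suppSpan (d : ℕ) (Γ : Measure (Ed d)) : Submodule ℝ (Ed d) :=
  Submodule.span ℝ {x : Ed d | ∀ U : Set (Ed d), IsOpen U → x ∈ U → 0 < Γ U}

/-- The `(M,Δ)`-negative feedback condition for an allocation function `g`. -/
def NegFeedback (d : ℕ) (ρ M Δ : ℝ) (Γ : Measure (Ed d)) (g : Ed d → Ed d → ℝ) : Prop :=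
  ∀ Λ : Ed d, Λ ∈ suppSpan d Γ → M ≤ ‖Λ‖ →
    (∫ X, (g Λ X - ρ) * (⟪X, Λ⟫ / ‖Λ‖) ∂Γ) ≤ -Δ

/-- `Γ` is sub-exponential: `∫ exp(λ‖X‖) dΓ(X) < ∞` for some `λ > 0`. -/
def SubExp (d : ℕ) (Γ : Measure (Ed d)) : Prop :=
  ∃ l : ℝ, 0 < l ∧ Integrable (fun x => Real.exp (l * ‖x‖)) Γ

/-- `k`-fold convolution power of a measure (`convPow μ 0` is the Dirac mass at `0`). -/
def convPow (d : ℕ) (μ : Measure (Ed d)) : ℕ → Measure (Ed d)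
  | 0 => Measure.dirac 0
  | n + 1 => ((convPow d μ n).prod μ).map (fun p => p.1 + p.2)

/-- A measure is spread out if some convolution power dominates `f·Leb` for a nonnegative
measurable `f` with `∫ f dLeb > 0`. -/
def SpreadOut (d : ℕ) (μ : Measure (Ed d)) : Prop :=
  ∃ k : ℕ, 0 < k ∧ ∃ f : Ed d → ℝ, Measurable f ∧ (∀ x, 0 ≤ f x) ∧
    (0 < ∫ x, f x) ∧
    ∀ A : Set (Ed d), MeasurableSet A →
      ENNReal.ofReal (∫ x in A, f x) ≤ convPow d μ k A

/-- `Γ_ρ`: the mixture `ρ·((1−ρ)·Γ) + (1−ρ)·((−ρ)·Γ)` of the pushforwards of `Γ` under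
scalar multiplication by `1−ρ` and by `−ρ`. -/
def mixMeasure (d : ℕ) (ρ : ℝ) (Γ : Measure (Ed d)) : Measure (Ed d) :=
  ENNReal.ofReal ρ • Γ.map (fun x => (1 - ρ) • x) +
    ENNReal.ofReal (1 - ρ) • Γ.map (fun x => (-ρ) • x)

/-- `π` is an invariant probability measure for the kernel `P_g`:
`π(A) = ∫ P_g(Λ, A) dπ(Λ)` for every Borel set `A`. -/
def IsInvariantMeasure (d : ℕ) (ρ : ℝ) (Γ : Measure (Ed d)) (g : Ed d → Ed d → ℝ)
    (π : Measure (Ed d)) : Prop :=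
  ∀ A : Set (Ed d), MeasurableSet A →
    (π A).toReal = ∫ Λ, kernelOp d ρ Γ g (A.indicator fun _ => (1 : ℝ)) Λ ∂π

/-- A measurable function bounded in absolute value by a multiple of `V`. -/
def DomBy {E : Type*} [MeasurableSpace E] (V φ : E → ℝ) : Prop :=
  Measurable φ ∧ ∃ C, ∀ x, |φ x| ≤ C * V x

/-- The averaging operator of a kernel. -/
def kernelAvg {E : Type*} [MeasurableSpace E] (κ : Kernel E E) (φ : E → ℝ) (x : E) : ℝ :=
  ∫ y, φ y ∂κ x

section Averaging

variable {E : Type*} [MeasurableSpace E] {V φ ψ : E → ℝ}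

lemma DomBy.lin (hφ : DomBy V φ) (hψ : DomBy V ψ) (a b : ℝ) :
    DomBy V (fun x => a * φ x + b * ψ x) := by
  obtain ⟨hm, C, hC⟩ := hφ
  obtain ⟨hm', D, hD⟩ := hψ
  refine ⟨(hm.const_mul a).add (hm'.const_mul b), |a| * C + |b| * D, fun x => ?_⟩
  calc |a * φ x + b * ψ x| ≤ |a| * |φ x| + |b| * |ψ x| := by
        rw [← abs_mul, ← abs_mul]; exact abs_add_le _ _
    _ ≤ |a| * (C * V x) + |b| * (D * V x) := by gcongr <;> apply_assumption
    _ = _ := by ring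

lemma DomBy.self (hV : Measurable V) (hV1 : ∀ x, 1 ≤ V x) : DomBy V V :=
  ⟨hV, 1, fun x => by rw [abs_of_nonneg (by linarith [hV1 x]), one_mul]⟩

lemma DomBy.of_bounded (hV1 : ∀ x, 1 ≤ V x) (hφ : Measurable φ) {B : ℝ}
    (hB : ∀ x, |φ x| ≤ B) : DomBy V φ := by
  refine ⟨hφ, B, fun x => (hB x).trans ?_⟩
  have := (abs_nonneg _).trans (hB x)
  nlinarith [hV1 x]

lemma DomBy.const (hV1 : ∀ x, 1 ≤ V x) (c : ℝ) : DomBy V (fun _ => c) :=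
  DomBy.of_bounded hV1 measurable_const (fun _ => le_rfl)

lemma DomBy.integrable (hφ : DomBy V φ) {μ : Measure E} (hμ : Integrable V μ) :
    Integrable φ μ := by
  obtain ⟨hm, C, hC⟩ := hφ
  exact (hμ.const_mul C).mono' hm.aestronglyMeasurable (Eventually.of_forall hC)

end Averaging

/-- Positive, normalised, linear operators on the functions dominated by `V` that satisfy the
geometric drift condition `Q V ≤ γ V + K`. -/
structure IsDriftOp {E : Type*} [MeasurableSpace E] (V : E → ℝ) (γ K : ℝ)
    (Q : (E → ℝ) → E → ℝ) : Prop where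
  dom : ∀ {φ}, DomBy V φ → DomBy V (Q φ)
  mono : ∀ {φ ψ}, DomBy V φ → DomBy V ψ → (∀ x, φ x ≤ ψ x) → ∀ x, Q φ x ≤ Q ψ x
  lin : ∀ {φ ψ}, DomBy V φ → DomBy V ψ → ∀ a b : ℝ, ∀ x,
    Q (fun y => a * φ y + b * ψ y) x = a * Q φ x + b * Q ψ x
  const : ∀ c : ℝ, ∀ x, Q (fun _ => c) x = c
  drift : ∀ x, Q V x ≤ γ * V x + K

section DriftOp

variable {E : Type*} [MeasurableSpace E] {V : E → ℝ} {γ K : ℝ} {Q : (E → ℝ) → E → ℝ}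

lemma isDriftOp_kernelAvg {κ : Kernel E E} [IsMarkovKernel κ]
    (hV1 : ∀ x, 1 ≤ V x) (hI : ∀ x, Integrable V (κ x)) (hK : 0 ≤ K)
    (hd : ∀ x, ∫ y, V y ∂κ x ≤ γ * V x + K) : IsDriftOp V γ K (kernelAvg κ) where
  dom := by
    intro φ hφ
    refine ⟨hφ.1.stronglyMeasurable.integral_kernel.measurable, ?_⟩
    obtain ⟨hm, C, hC⟩ := hφ
    refine ⟨|C| * (γ + K), fun x => ?_⟩
    calc |kernelAvg κ φ x| ≤ ∫ y, |φ y| ∂κ x := abs_integral_le_integral_abs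
      _ ≤ ∫ y, |C| * V y ∂κ x := by
          refine integral_mono_of_nonneg (Eventually.of_forall fun y => abs_nonneg _)
            ((hI x).const_mul _) (Eventually.of_forall fun y => (hC y).trans ?_)
          exact mul_le_mul_of_nonneg_right (le_abs_self C) (by linarith [hV1 y])
      _ = |C| * ∫ y, V y ∂κ x := integral_const_mul _ _
      _ ≤ |C| * (γ * V x + K) := by gcongr; exact hd x
      _ ≤ |C| * ((γ + K) * V x) := by gcongr; nlinarith [hV1 x]
      _ = _ := by ring
  mono := fun hφ hψ h x => integral_mono (hφ.integrable (hI x)) (hψ.integrable (hI x)) h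
  lin := fun hφ hψ a b x => by
    simp only [kernelAvg]
    rw [integral_add ((hφ.integrable (hI x)).const_mul a) ((hψ.integrable (hI x)).const_mul b),
      integral_const_mul, integral_const_mul]
  const := fun c x => by simp [kernelAvg]
  drift := hd

lemma IsDriftOp.iterate_drift (hQ : IsDriftOp V γ K Q) (hV : Measurable V) (hV1 : ∀ x, 1 ≤ V x)
    (hγ : γ ∈ Ioo (0 : ℝ) 1) (hK : 0 ≤ K) (n : ℕ) :
    IsDriftOp V (γ ^ n) (K / (1 - γ)) Q^[n] := by
  have h1 : 0 < 1 - γ := by linarith [hγ.2]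
  induction n with
  | zero =>
    refine ⟨fun h => h, fun _ _ h => h, fun _ _ _ _ _ => rfl, fun _ _ => rfl, fun x => ?_⟩
    have : 0 ≤ K / (1 - γ) := by positivity
    simpa using this
  | succ n ih =>
    simp only [Function.iterate_succ]
    refine ⟨fun h => ih.dom (hQ.dom h), fun h h' hl => ih.mono (hQ.dom h) (hQ.dom h')
      (hQ.mono h h' hl), fun {φ ψ} h h' a b x => ?_, fun c x => ?_, fun x => ?_⟩
    · have : Q (fun y => a * φ y + b * ψ y) = fun y => a * Q φ y + b * Q ψ y :=
        funext (hQ.lin h h' a b)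
      simp only [Function.comp_apply, this]
      exact ih.lin (hQ.dom h) (hQ.dom h') a b x
    · have : Q (fun _ => c) = fun _ => c := funext (hQ.const c)
      simp only [Function.comp_apply, this, ih.const]
    · have hVV := DomBy.self hV hV1
      calc Q^[n] (Q V) x ≤ Q^[n] (fun y => γ * V y + K * 1) x :=
            ih.mono (hQ.dom hVV) (hVV.lin (DomBy.const hV1 1) _ _)
              (fun y => by simpa using hQ.drift y) x
        _ = γ * Q^[n] V x + K * Q^[n] (fun _ => 1) x :=
            ih.lin hVV (DomBy.const hV1 1) _ _ x
        _ ≤ γ * (γ ^ n * V x + K / (1 - γ)) + K := by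
            rw [ih.const, mul_one]
            have := ih.drift x
            have := hγ.1
            gcongr
        _ = _ := by field_simp; ring

end DriftOp

/-- A bound on all differences of a function by a sum of weights is a weighted bound on the
distance to some constant. -/
lemma exists_abs_sub_le_of_sub_le {E : Type*} [Nonempty E] {φ w : E → ℝ}
    (h : ∀ x y, φ x - φ y ≤ w x + w y) : ∃ c, ∀ x, |φ x - c| ≤ w x := by
  obtain ⟨c, hc, hc'⟩ := exists_between_of_forall_le
    (s := range fun x => φ x - w x) (t := range fun y => φ y + w y)
    (range_nonempty _) (range_nonempty _) (by
      rintro _ ⟨x, rfl⟩ _ ⟨y, rfl⟩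
      linarith [h x y])
  refine ⟨c, fun x => abs_le.2 ⟨?_, ?_⟩⟩
  · linarith [hc' ⟨x, rfl⟩]
  · linarith [hc ⟨x, rfl⟩]

lemma exists_contraction_rate {γ K ε R : ℝ} (hγ : γ ∈ Ioo (0 : ℝ) 1) (hK : 0 < K)
    (hε : ε ∈ Ioc (0 : ℝ) 1) (hR : 4 * K ≤ (1 - γ) * R) :
    ∃ β > 0, ∃ α ∈ Ioo (0 : ℝ) 1,
      (∀ S, R ≤ S → 2 + β * (γ * S + 2 * K) ≤ α * (2 + β * S)) ∧
      ∀ S, 0 ≤ S → 2 * (1 - ε) + β * (γ * S + 2 * K) ≤ α * (2 + β * S) := by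
  obtain ⟨hγ0, hγ1⟩ := hγ
  obtain ⟨hε0, hε1⟩ := hε
  have hR0 : 0 < R := by
    by_contra! h
    nlinarith
  set β := ε / (2 * K) with hβ
  have hβ0 : 0 < β := by positivity
  have hβK : β * (2 * K) = ε := by rw [hβ]; field_simp
  set δ := min (β * R * (1 - γ) / (2 * (2 + β * R))) (min (ε / 2) (1 - γ)) with hδ
  have hd : 0 < 2 * (2 + β * R) := by positivity
  have hg : 0 < 1 - γ := by linarith
  have h1 : δ * (2 * (2 + β * R)) ≤ β * R * (1 - γ) := by
    rw [← le_div_iff₀ hd]; exact min_le_left _ _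
  have h2 : δ ≤ ε / 2 := (min_le_right _ _).trans (min_le_left _ _)
  have h3 : δ ≤ 1 - γ := (min_le_right _ _).trans (min_le_right _ _)
  have hδ0 : 0 < δ := by
    refine lt_min (div_pos (by positivity) hd) (lt_min (by positivity) hg)
  have h4 : 2 * δ ≤ 1 - γ := by
    by_contra! h
    nlinarith [mul_pos hβ0 hR0]
  refine ⟨β, hβ0, 1 - δ, ⟨by linarith, by linarith⟩, fun S hS => ?_, fun S hS => ?_⟩
  · have h5 : β * (4 * K) ≤ β * ((1 - γ) * S) :=
      mul_le_mul_of_nonneg_left (hR.trans (mul_le_mul_of_nonneg_left hS hg.le)) hβ0.le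
    have h6 : 0 ≤ β * (S - R) * (1 - γ - 2 * δ) := by
      have : 0 ≤ S - R := by linarith
      have : 0 ≤ 1 - γ - 2 * δ := by linarith
      positivity
    nlinarith
  · have : 0 ≤ β * S * (1 - γ - δ) := by
      have : 0 ≤ 1 - γ - δ := by linarith
      positivity
    nlinarith

section Contraction

variable {E : Type*} [MeasurableSpace E] {V : E → ℝ} {γ K : ℝ} {Q : (E → ℝ) → E → ℝ}

/-- One step of the weighted contraction of Hairer and Mattingly. -/
lemma IsDriftOp.contraction [Nonempty E] (hQ : IsDriftOp V γ K Q) (hV : Measurable V)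
    (hV1 : ∀ x, 1 ≤ V x) {ε R β α : ℝ} (hβ : 0 < β) (hε : 0 < ε) {ν : Measure E}
    [IsProbabilityMeasure ν] (hν : Integrable V ν)
    (hmin : ∀ φ, DomBy V φ → (∀ x, 0 ≤ φ x) → ∀ x, V x ≤ R → ε * ∫ y, φ y ∂ν ≤ Q φ x)
    (h1 : ∀ S, R ≤ S → 2 + β * (γ * S + 2 * K) ≤ α * (2 + β * S))
    (h2 : ∀ S, 0 ≤ S → 2 * (1 - ε) + β * (γ * S + 2 * K) ≤ α * (2 + β * S))
    {φ : E → ℝ} (hφ : DomBy V φ) {a c : ℝ} (ha : 0 ≤ a)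
    (hc : ∀ x, |φ x - c| ≤ a * (1 + β * V x)) :
    ∃ c', ∀ x, |Q φ x - c'| ≤ α * a * (1 + β * V x) := by
  have hVV := DomBy.self hV hV1
  have hone := DomBy.const hV1 1
  set w : E → ℝ := fun y => a * 1 + (a * β) * V y with hw
  have hwd : DomBy V w := hone.lin hVV _ _
  have hQw : ∀ x, Q w x ≤ a + a * β * (γ * V x + K) := fun x => by
    rw [hw, hQ.lin hone hVV, hQ.const, mul_one]
    have := hQ.drift x
    gcongr
  set ψ : E → ℝ := fun y => 1 * φ y + (-c) * 1 with hψ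
  have hψd : DomBy V ψ := hφ.lin hone _ _
  have hQψ : ∀ x, Q ψ x = Q φ x - c := fun x => by
    rw [hψ, hQ.lin hφ hone, hQ.const]; ring
  have hψw : ∀ x, |ψ x| ≤ w x := fun x => by
    have := hc x
    rw [show ψ x = φ x - c by simp [hψ]; ring]
    refine this.trans (le_of_eq ?_)
    simp [hw]; ring
  have hle : ∀ s : ℝ, |s| = 1 → ∀ x, s * Q ψ x ≤ Q w x := fun s hs x => by
    have := hQ.mono (hψd.lin hone s 0) hwd (fun y => by
      have : s * ψ y ≤ |s * ψ y| := le_abs_self _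
      rw [abs_mul, hs, one_mul] at this
      linarith [hψw y]) x
    rwa [hQ.lin hψd hone, zero_mul, add_zero] at this
  have hle' : ∀ s : ℝ, |s| = 1 → ∀ x, V x ≤ R →
      s * Q ψ x ≤ Q w x - ε * ∫ y, w y ∂ν + s * ε * ∫ y, ψ y ∂ν := fun s hs x hx => by
    have := hmin _ (hwd.lin hψd 1 (-s)) (fun y => by
      have : s * ψ y ≤ |s * ψ y| := le_abs_self _
      rw [abs_mul, hs, one_mul] at this
      linarith [hψw y]) x hx
    rw [hQ.lin hwd hψd, integral_add ((hwd.integrable hν).const_mul _)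
      ((hψd.integrable hν).const_mul _), integral_const_mul, integral_const_mul] at this
    linarith
  have hνw : a ≤ ∫ y, w y ∂ν := by
    have : ∫ _, a ∂ν ≤ ∫ y, w y ∂ν := integral_mono (integrable_const a) (hwd.integrable hν)
      (fun y => by
        have : 0 ≤ a * β * V y := by
          have := hV1 y
          positivity
        simp only [hw]; linarith)
    simpa using this
  refine exists_abs_sub_le_of_sub_le (w := fun x => α * a * (1 + β * V x)) fun x y => ?_
  have hx := hV1 x
  have hy := hV1 y
  have hgoal : ∀ T, T ≤ α * (2 + β * (V x + V y)) →
      a * T ≤ α * a * (1 + β * V x) + α * a * (1 + β * V y) := fun T hT => by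
    calc a * T ≤ a * (α * (2 + β * (V x + V y))) := by gcongr
      _ = _ := by ring
  rcases le_total R (V x + V y) with h | h
  · refine le_trans ?_ (hgoal _ (h1 _ h))
    have e1 := hle 1 (by simp) x
    have e2 := hle (-1) (by simp) y
    rw [hQψ] at e1 e2
    linarith [hQw x, hQw y]
  · refine le_trans ?_ (hgoal _ (h2 (V x + V y) (by linarith)))
    have e1 := hle' 1 (by simp) x (by linarith)
    have e2 := hle' (-1) (by simp) y (by linarith)
    rw [hQψ] at e1 e2
    have : ε * a ≤ ε * ∫ y, w y ∂ν := by gcongr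
    linarith [hQw x, hQw y]

/-- Geometric decay of differences for iterates of an operator with geometric drift and a
minorisation condition; the constants depend only on the parameters of these conditions. -/
theorem exists_geometric_decay (E : Type*) [MeasurableSpace E] [Nonempty E] {V : E → ℝ}
    (hV : Measurable V) (hV1 : ∀ x, 1 ≤ V x) {γ K ε R : ℝ} {m : ℕ} (hγ : γ ∈ Ioo (0 : ℝ) 1)
    (hK : 0 < K) (hε : ε ∈ Ioc (0 : ℝ) 1) (hm : 0 < m) (hR : 4 * (K / (1 - γ)) ≤ (1 - γ) * R)
    (ν : Measure E) [IsProbabilityMeasure ν] (hν : Integrable V ν) :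
    ∃ C > 0, ∃ r ∈ Ioo (0 : ℝ) 1, ∀ P : (E → ℝ) → E → ℝ, IsDriftOp V γ K P →
      (∀ φ, DomBy V φ → (∀ x, 0 ≤ φ x) → ∀ x, V x ≤ R → ε * ∫ y, φ y ∂ν ≤ P^[m] φ x) →
      ∀ φ B, Measurable φ → (∀ x, |φ x| ≤ B) → ∀ n x y,
        |P^[n] φ x - P^[n] φ y| ≤ B * C * r ^ n * (V x + V y) := by
  have hg : 0 < 1 - γ := by linarith [hγ.2]
  have hγm : γ ^ m ∈ Ioo (0 : ℝ) 1 := ⟨pow_pos hγ.1 m, pow_lt_one₀ hγ.1.le hγ.2 hm.ne'⟩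
  have hγle : γ ^ m ≤ γ := pow_le_of_le_one hγ.1.le hγ.2.le hm.ne'
  have hR0 : 0 < R := by
    by_contra! h
    have : 0 < K / (1 - γ) := by positivity
    nlinarith
  obtain ⟨β, hβ, α, hα, h1, h2⟩ := exists_contraction_rate (K := K / (1 - γ)) (R := R) hγm
    (by positivity) hε (hR.trans (by gcongr))
  have hm' : (0 : ℝ) < m := by exact_mod_cast hm
  have hm1 : (1 : ℝ) ≤ m := by exact_mod_cast hm
  set r : ℝ := 1 - (1 - α) / m with hr
  have hα1 : 0 < 1 - α := by linarith [hα.2]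
  have hq : (1 - α) / m < 1 := by rw [div_lt_one hm']; linarith [hα.1]
  have hq0 : 0 < (1 - α) / m := by positivity
  have hr0 : 0 < r := by linarith
  have hr1 : r < 1 := by linarith
  have hrm : α ≤ r ^ m := by
    have := one_add_mul_le_pow (a := -((1 - α) / m)) (by linarith) m
    have e : 1 + (m : ℝ) * -((1 - α) / m) = α := by field_simp; ring
    rw [e] at this
    simpa [hr, sub_eq_add_neg] using this
  refine ⟨(1 + β) / α, div_pos (by linarith) hα.1, r, ⟨hr0, hr1⟩, ?_⟩
  intro P hP hmin φ B hφ hB n x y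
  have hB0 : 0 ≤ B := (abs_nonneg _).trans (hB x)
  have hPn := fun n => hP.iterate_drift hV hV1 hγ hK.le n
  have key : ∀ q, ∀ ψ, DomBy V ψ → (∀ x, |ψ x| ≤ B) →
      ∃ c, ∀ x, |(P^[m])^[q] ψ x - c| ≤ α ^ q * B * (1 + β * V x) := by
    intro q ψ hψ hψB
    induction q with
    | zero =>
      refine ⟨0, fun x => ?_⟩
      simp only [Function.iterate_zero, id, sub_zero, pow_zero, one_mul]
      have := hV1 x
      refine (hψB x).trans (le_mul_of_one_le_right hB0 ?_)
      have : 0 ≤ β * V x := by positivity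
      linarith
    | succ q ih =>
      obtain ⟨c, hc⟩ := ih
      have hd : DomBy V ((P^[m])^[q] ψ) := by
        rw [← Function.iterate_mul]; exact (hPn _).dom hψ
      obtain ⟨c', hc'⟩ := (hPn m).contraction hV hV1 hβ hε.1 hν hmin h1 h2 hd
        (mul_nonneg (pow_nonneg hα.1.le q) hB0) hc
      refine ⟨c', fun x => ?_⟩
      rw [Function.iterate_succ', pow_succ']
      simpa [mul_assoc] using hc' x
  have hφd := DomBy.of_bounded hV1 hφ hB
  have hsB : ∀ s x, |P^[s] φ x| ≤ B := fun s x => by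
    have hBd := DomBy.const hV1 B
    have hBd' := DomBy.const hV1 (-B)
    refine abs_le.2 ⟨?_, ?_⟩
    · rw [← (hPn s).const (-B) x]
      exact (hPn s).mono hBd' hφd (fun y => (abs_le.1 (hB y)).1) x
    · rw [← (hPn s).const B x]
      exact (hPn s).mono hφd hBd (fun y => (abs_le.1 (hB y)).2) x
  obtain ⟨c, hc⟩ := key (n / m) (P^[n % m] φ) ((hPn _).dom hφd) (hsB _)
  have hn : (P^[m])^[n / m] (P^[n % m] φ) = P^[n] φ := by
    rw [← Function.iterate_mul, ← Function.iterate_add_apply, Nat.div_add_mod]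
  rw [hn] at hc
  have hpow : α ^ (n / m) ≤ r ^ n / α := by
    rw [le_div_iff₀ hα.1]
    calc α ^ (n / m) * α ≤ (r ^ m) ^ (n / m) * r ^ m := by
          have := hα.1.le
          gcongr
      _ ≤ (r ^ m) ^ (n / m) * r ^ (n % m) := by
          gcongr ?_ * ?_
          exact pow_le_pow_of_le_one hr0.le hr1.le (Nat.mod_lt _ hm).le
      _ = r ^ n := by rw [← pow_mul, ← pow_add, Nat.div_add_mod]
  have hx := hV1 x
  have hy := hV1 y
  calc |P^[n] φ x - P^[n] φ y| ≤ |P^[n] φ x - c| + |P^[n] φ y - c| := by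
        rw [abs_sub_comm (P^[n] φ y) c]; exact abs_sub_le _ _ _
    _ ≤ α ^ (n / m) * B * (1 + β * V x) + α ^ (n / m) * B * (1 + β * V y) :=
        add_le_add (hc x) (hc y)
    _ = α ^ (n / m) * (B * (2 + β * (V x + V y))) := by ring
    _ ≤ r ^ n / α * (B * ((1 + β) * (V x + V y))) := by
        gcongr ?_ * (B * ?_)
        · exact div_nonneg (pow_nonneg hr0.le n) hα.1.le
        · linarith
    _ = _ := by ring

end Contraction

open scoped Topology

/-- A setwise limit of probability measures that is uniform over measurable sets is a
probability measure. -/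
lemma exists_measure_of_uniform_limit {E : Type*} [MeasurableSpace E] (μ : ℕ → Measure E)
    [∀ n, IsProbabilityMeasure (μ n)] (ℓ : Set E → ℝ) (b : ℕ → ℝ) (hb : Tendsto b atTop (𝓝 0))
    (h : ∀ n A, MeasurableSet A → |(μ n).real A - ℓ A| ≤ b n) :
    ∃ π : Measure E, IsProbabilityMeasure π ∧ ∀ A, MeasurableSet A → π.real A = ℓ A := by
  have hlim : ∀ A, MeasurableSet A → Tendsto (fun n => (μ n).real A) atTop (𝓝 (ℓ A)) :=
    fun A hA => by
      rw [tendsto_iff_dist_tendsto_zero]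
      exact squeeze_zero (fun _ => dist_nonneg) (fun n => h n A hA) hb
  have hnn : ∀ A, MeasurableSet A → 0 ≤ ℓ A := fun A hA =>
    ge_of_tendsto' (hlim A hA) fun _ => measureReal_nonneg
  have hemp : ℓ ∅ = 0 := tendsto_nhds_unique (hlim ∅ .empty) (by simp)
  have huniv : ℓ univ = 1 := tendsto_nhds_unique (hlim univ .univ) (by simp)
  have hsum : ∀ f : ℕ → Set E, (∀ i, MeasurableSet (f i)) → Pairwise (Function.onFun Disjoint f) →
      HasSum (fun i => ℓ (f i)) (ℓ (⋃ i, f i)) := by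
    intro f hf hd
    have hfin : ∀ n (s : Finset ℕ),
        ∑ i ∈ s, (μ n).real (f i) = (μ n).real (⋃ i ∈ s, f i) := fun n s =>
      (measureReal_biUnion_finset (fun i _ j _ hij => hd hij) (fun i _ => hf i)).symm
    have hfinl : ∀ s : Finset ℕ, ∑ i ∈ s, ℓ (f i) = ℓ (⋃ i ∈ s, f i) := fun s => by
      refine tendsto_nhds_unique (tendsto_finsetSum s fun i _ => hlim _ (hf i)) ?_
      simp only [hfin]
      exact hlim _ (s.measurableSet_biUnion fun i _ => hf i)
    have hu : TendstoUniformly (fun n (s : Finset ℕ) => ∑ i ∈ s, (μ n).real (f i))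
        (fun s => ∑ i ∈ s, ℓ (f i)) atTop := by
      rw [Metric.tendstoUniformly_iff]
      intro ε hε
      filter_upwards [hb.eventually_lt_const hε] with n hn s
      rw [dist_comm, hfin, hfinl]
      exact (h n _ (s.measurableSet_biUnion fun i _ => hf i)).trans_lt hn
    refine hu.tendsto_of_eventually_tendsto (L := fun n => (μ n).real (⋃ i, f i))
      (Eventually.of_forall fun n => ?_) (hlim _ (.iUnion hf))
    have h1 := measure_iUnion (μ := μ n) hd hf
    have h2 : ∑' i, μ n (f i) ≠ ⊤ := by rw [← h1]; exact measure_ne_top _ _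
    have h3 := ENNReal.hasSum_toReal h2
    rwa [← ENNReal.tsum_toReal_eq (ENNReal.ne_top_of_tsum_ne_top h2), ← h1] at h3
  let π := Measure.ofMeasurable (fun A _ => ENNReal.ofReal (ℓ A)) (by simp [hemp])
    (fun f hf hd => by
      rw [← (hsum f hf hd).tsum_eq,
        ENNReal.ofReal_tsum_of_nonneg (fun i => hnn _ (hf i)) (hsum f hf hd).summable])
  have hπ : ∀ A, MeasurableSet A → π A = ENNReal.ofReal (ℓ A) :=
    fun A hA => Measure.ofMeasurable_apply A hA
  refine ⟨π, ⟨by rw [hπ _ .univ, huniv, ENNReal.ofReal_one]⟩, fun A hA => ?_⟩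
  rw [Measure.real, hπ A hA, ENNReal.toReal_ofReal (hnn A hA)]

/-- Setwise convergence of probability measures gives convergence of integrals of measurable
functions with values in `[0, 1]`. -/
lemma tendsto_integral_of_tendsto_measureReal {E : Type*} [MeasurableSpace E]
    {μ : ℕ → Measure E} {π : Measure E} [∀ n, IsProbabilityMeasure (μ n)] [IsProbabilityMeasure π]
    (h : ∀ A, MeasurableSet A → Tendsto (fun n => (μ n).real A) atTop (𝓝 (π.real A)))
    {φ : E → ℝ} (hφ : Measurable φ) (h0 : ∀ x, 0 ≤ φ x) (h1 : ∀ x, φ x ≤ 1) :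
    Tendsto (fun n => ∫ x, φ x ∂μ n) atTop (𝓝 (∫ x, φ x ∂π)) := by
  have hintg : ∀ ν : Measure E, IsProbabilityMeasure ν →
      ∫ x, φ x ∂ν = (∫⁻ t in Ioi (0 : ℝ), ν {a | t < φ a}).toReal := fun ν _ => by
    rw [← lintegral_eq_lintegral_meas_lt ν (Eventually.of_forall h0) hφ.aemeasurable,
      integral_eq_lintegral_of_nonneg_ae (Eventually.of_forall h0) hφ.aestronglyMeasurable]
  rw [hintg π inferInstance]
  simp only [fun n => hintg (μ n) inferInstance]
  have hbound : ∀ ν : Measure E, IsProbabilityMeasure ν → ∀ t : ℝ,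
      ν {a | t < φ a} ≤ (Iio (1 : ℝ)).indicator (fun _ => 1) t := fun ν _ t => by
    by_cases ht : t < 1
    · rw [indicator_of_mem (show t ∈ Iio (1 : ℝ) from ht)]; exact prob_le_one
    · have : {a | t < φ a} = ∅ := by
        ext a; simpa using (h1 a).trans (not_lt.1 ht)
      simp [this]
  have hfin : ∫⁻ t in Ioi (0 : ℝ), (Iio (1 : ℝ)).indicator (fun _ => (1 : ℝ≥0∞)) t ≠ ⊤ := by
    rw [lintegral_indicator measurableSet_Iio, Measure.restrict_restrict measurableSet_Iio]
    simp [Iio_inter_Ioi]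
  refine (ENNReal.continuousAt_toReal ?_).tendsto.comp ?_
  · exact ne_top_of_le_ne_top hfin (lintegral_mono fun t => hbound π inferInstance t)
  · refine tendsto_lintegral_of_dominated_convergence _ (fun n => ?_)
      (fun n => Eventually.of_forall (hbound (μ n) inferInstance)) hfin
      (Eventually.of_forall fun t => ?_)
    · exact Antitone.measurable fun s t hst => measure_mono fun a (ha : t < φ a) => hst.trans_lt ha
    · have := h {a | t < φ a} (measurableSet_lt measurable_const hφ)
      simp only [Measure.real] at this
      rwa [ENNReal.tendsto_toReal_iff (fun _ => measure_ne_top _ _) (measure_ne_top _ _)] at this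

lemma integral_bind_kernel {E : Type*} [MeasurableSpace E] (κ : Kernel E E) [IsMarkovKernel κ]
    (μ : Measure E) [IsProbabilityMeasure μ] {φ : E → ℝ} (hφ : Measurable φ) {B : ℝ}
    (hB : ∀ x, |φ x| ≤ B) : ∫ x, φ x ∂(μ.bind κ) = ∫ x, kernelAvg κ φ x ∂μ := by
  have := Kernel.integral_comp (η := κ) (κ := Kernel.const Unit μ) (a := ()) (f := φ) (by
    refine Integrable.of_bound hφ.aestronglyMeasurable B (Eventually.of_forall hB))
  rwa [Kernel.comp_apply, Kernel.const_apply] at this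

lemma measurable_kernelAvg {E : Type*} [MeasurableSpace E] {κ : Kernel E E} {φ : E → ℝ}
    (hφ : Measurable φ) : Measurable (kernelAvg κ φ) :=
  hφ.stronglyMeasurable.integral_kernel.measurable

section Ergodic

variable {E : Type*} [MeasurableSpace E] {V : E → ℝ} {γ K C r : ℝ} {κ : Kernel E E}
  [IsMarkovKernel κ]

lemma abs_kernelAvg_le {φ : E → ℝ} {B : ℝ} (hB : ∀ x, |φ x| ≤ B) (x : E) :
    |kernelAvg κ φ x| ≤ B := by
  have := norm_integral_le_of_norm_le_const (μ := κ x) (f := φ) (Eventually.of_forall hB)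
  simpa [kernelAvg] using this

lemma kernelAvg_iterate_bounded {φ : E → ℝ} (hφ : Measurable φ) {B : ℝ}
    (hB : ∀ x, |φ x| ≤ B) (n : ℕ) :
    Measurable ((kernelAvg κ)^[n] φ) ∧ ∀ x, |(kernelAvg κ)^[n] φ x| ≤ B := by
  induction n with
  | zero => exact ⟨hφ, hB⟩
  | succ n ih =>
    rw [Function.iterate_succ']
    exact ⟨measurable_kernelAvg ih.1, abs_kernelAvg_le ih.2⟩

lemma integral_iterate_of_invariant {π : Measure E} [IsProbabilityMeasure π]
    (hπ : π.bind κ = π) {φ : E → ℝ} (hφ : Measurable φ) {B : ℝ} (hB : ∀ x, |φ x| ≤ B) (n : ℕ) :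
    ∫ x, (kernelAvg κ)^[n] φ x ∂π = ∫ x, φ x ∂π := by
  induction n with
  | zero => rfl
  | succ n ih =>
    obtain ⟨hm, hb⟩ := kernelAvg_iterate_bounded (κ := κ) hφ hB n
    rw [Function.iterate_succ', Function.comp_apply, ← integral_bind_kernel κ π hm hb, hπ, ih]

/-- If differences of iterates decay geometrically then iterates converge pointwise to the
integral against any invariant probability measure. -/
lemma tendsto_iterate_of_invariant (hr : r ∈ Ioo (0 : ℝ) 1)
    (hdecay : ∀ φ B, Measurable φ → (∀ x, |φ x| ≤ B) → ∀ n x y,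
      |(kernelAvg κ)^[n] φ x - (kernelAvg κ)^[n] φ y| ≤ B * C * r ^ n * (V x + V y))
    {π : Measure E} [IsProbabilityMeasure π] (hπ : π.bind κ = π) {φ : E → ℝ} (hφ : Measurable φ)
    {B : ℝ} (hB : ∀ x, |φ x| ≤ B) (x : E) :
    Tendsto (fun n => (kernelAvg κ)^[n] φ x) atTop (𝓝 (∫ y, φ y ∂π)) := by
  have hb := fun n => kernelAvg_iterate_bounded (κ := κ) hφ hB n
  have hI : ∀ n, Integrable ((kernelAvg κ)^[n] φ) π := fun n =>
    Integrable.of_bound (hb n).1.aestronglyMeasurable B (Eventually.of_forall (hb n).2)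
  have hlim : Tendsto (fun n => ∫ y, ((kernelAvg κ)^[n] φ x - (kernelAvg κ)^[n] φ y) ∂π) atTop
      (𝓝 (∫ _, (0 : ℝ) ∂π)) := by
    refine tendsto_integral_of_dominated_convergence (fun _ => B + B)
      (fun n => (measurable_const.sub (hb n).1).aestronglyMeasurable) (integrable_const _)
      (fun n => Eventually.of_forall fun y => ?_) (Eventually.of_forall fun y => ?_)
    · exact (norm_sub_le _ _).trans (add_le_add ((hb n).2 x) ((hb n).2 y))
    · refine squeeze_zero_norm (hdecay φ B hφ hB · x y) ?_
      have := tendsto_pow_atTop_nhds_zero_of_lt_one hr.1.le hr.2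
      simpa using (this.const_mul (B * C)).mul_const (V x + V y)
  have heq : ∀ n, ∫ y, ((kernelAvg κ)^[n] φ x - (kernelAvg κ)^[n] φ y) ∂π =
      (kernelAvg κ)^[n] φ x - ∫ y, φ y ∂π := fun n => by
    rw [integral_sub (integrable_const _) (hI n), integral_iterate_of_invariant hπ hφ hB]
    simp
  simp only [heq, integral_zero] at hlim
  simpa using hlim.add_const (∫ y, φ y ∂π)

lemma dist_iterate_succ_le (hV : Measurable V) (hV1 : ∀ x, 1 ≤ V x)
    (hop : IsDriftOp V γ K (kernelAvg κ)) (hK : 0 ≤ K) (hC : 0 ≤ C) (hr : r ∈ Ioo (0 : ℝ) 1)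
    (hdecay : ∀ φ B, Measurable φ → (∀ x, |φ x| ≤ B) → ∀ n x y,
      |(kernelAvg κ)^[n] φ x - (kernelAvg κ)^[n] φ y| ≤ B * C * r ^ n * (V x + V y))
    {φ : E → ℝ} (hφ : Measurable φ) {B : ℝ} (hB : ∀ x, |φ x| ≤ B) (x : E) (n : ℕ) :
    dist ((kernelAvg κ)^[n] φ x) ((kernelAvg κ)^[n + 1] φ x) ≤
      (B * C * ((γ + K + 1) * V x)) * r ^ n := by
  have hB0 : 0 ≤ B := (abs_nonneg _).trans (hB x)
  obtain ⟨hm, hb⟩ := kernelAvg_iterate_bounded (κ := κ) hφ hB n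
  set ψ := (kernelAvg κ)^[n] φ with hψ
  have hψd := DomBy.of_bounded hV1 hm hb
  have hVd := DomBy.self hV hV1
  have hone := DomBy.const hV1 1
  set b := B * C * r ^ n with hbdef
  have hb0 : 0 ≤ b := by have := hr.1; positivity
  have hx := hV1 x
  have hdr : b * kernelAvg κ V x ≤ b * (γ * V x + K) := by gcongr; exact hop.drift x
  have hfin : b * (γ * V x + K) + b * V x ≤ (B * C * ((γ + K + 1) * V x)) * r ^ n := by
    calc b * (γ * V x + K) + b * V x = b * ((γ + 1) * V x + K * 1) := by ring
      _ ≤ b * ((γ + 1) * V x + K * V x) := by gcongr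
      _ = _ := by rw [hbdef]; ring
  have hdec := fun y => abs_le.1 (hdecay φ B hφ hB n y x)
  have h1 := hop.mono hψd (hVd.lin hone b (b * V x + ψ x)) (fun y => by
    linarith [(hdec y).2]) x
  have h2 := hop.mono (hVd.lin hone (-b) (-(b * V x) + ψ x)) hψd (fun y => by
    linarith [(hdec y).1]) x
  rw [hop.lin hVd hone, hop.const] at h1 h2
  rw [Function.iterate_succ', Function.comp_apply, Real.dist_eq, abs_le, ← hψ]
  constructor <;> linarith

/-- Existence, uniqueness and geometric ergodicity of the invariant probability measure from
geometric decay of differences of iterates. -/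
theorem exists_unique_invariant [Nonempty E] (hV : Measurable V) (hV1 : ∀ x, 1 ≤ V x)
    (hop : IsDriftOp V γ K (kernelAvg κ)) (hK : 0 ≤ K) (hC : 0 ≤ C) (hr : r ∈ Ioo (0 : ℝ) 1)
    (hdecay : ∀ φ B, Measurable φ → (∀ x, |φ x| ≤ B) → ∀ n x y,
      |(kernelAvg κ)^[n] φ x - (kernelAvg κ)^[n] φ y| ≤ B * C * r ^ n * (V x + V y)) :
    ∃ π : Measure E, IsProbabilityMeasure π ∧ π.bind κ = π ∧
      (∀ π' : Measure E, IsProbabilityMeasure π' → π'.bind κ = π' → π' = π) ∧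
      ∀ φ B, Measurable φ → (∀ x, |φ x| ≤ B) → ∀ n x,
        |(kernelAvg κ)^[n] φ x - ∫ y, φ y ∂π| ≤
          (B * C * ((γ + K + 1) * V x)) * r ^ n / (1 - r) := by
  have hstep := fun φ B hφ hB x n => dist_iterate_succ_le (φ := φ) (B := B) hV hV1 hop hK hC hr
    hdecay hφ hB x n
  let x₀ : E := Classical.arbitrary E
  let μ : ℕ → Measure E := fun n => (fun m : Measure E => m.bind κ)^[n] (Measure.dirac x₀)
  have hμs : ∀ n, μ (n + 1) = (μ n).bind κ := fun n => by
    simp only [μ, Function.iterate_succ', Function.comp_apply]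
  have hμp : ∀ n, IsProbabilityMeasure (μ n) := by
    intro n
    induction n with
    | zero => exact inferInstanceAs (IsProbabilityMeasure (Measure.dirac x₀))
    | succ n ih => rw [hμs]; infer_instance
  have hμint : ∀ n φ B, Measurable φ → (∀ x, |φ x| ≤ B) →
      ∫ x, φ x ∂μ n = (kernelAvg κ)^[n] φ x₀ := by
    intro n
    induction n with
    | zero =>
      intro φ B hφ _
      exact integral_dirac' _ _ hφ.stronglyMeasurable
    | succ n ih =>
      intro φ B hφ hB
      rw [hμs, integral_bind_kernel κ _ hφ hB, ih _ B (measurable_kernelAvg hφ)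
        (abs_kernelAvg_le hB), Function.iterate_succ_apply]
  have hind : ∀ A : Set E, ∀ x, |A.indicator (fun _ => (1 : ℝ)) x| ≤ 1 := fun A x => by
    by_cases hx : x ∈ A <;> simp [hx]
  have hμA : ∀ n A, MeasurableSet A →
      (μ n).real A = (kernelAvg κ)^[n] (A.indicator fun _ => (1 : ℝ)) x₀ := fun n A hA => by
    rw [← hμint n _ 1 (measurable_const.indicator hA) (hind A)]
    exact (integral_indicator_one hA).symm
  have hcauchy := fun A (hA : MeasurableSet A) => cauchySeq_tendsto_of_complete
    (cauchySeq_of_le_geometric r _ hr.2 (hstep _ 1 (measurable_const.indicator hA) (hind A) x₀))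
  choose! ℓ hℓ using hcauchy
  obtain ⟨π, hπp, hπℓ⟩ := exists_measure_of_uniform_limit μ ℓ
    (fun n => (1 * C * ((γ + K + 1) * V x₀)) * r ^ n / (1 - r)) (by
      have := tendsto_pow_atTop_nhds_zero_of_lt_one hr.1.le hr.2
      simpa using (this.const_mul (1 * C * ((γ + K + 1) * V x₀))).div_const (1 - r))
    (fun n A hA => by
      rw [hμA n A hA]
      exact dist_le_of_le_geometric_of_tendsto r _ hr.2
        (hstep _ 1 (measurable_const.indicator hA) (hind A) x₀) (hℓ A hA) n)
  have hset : ∀ A, MeasurableSet A → Tendsto (fun n => (μ n).real A) atTop (𝓝 (π.real A)) :=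
    fun A hA => by
      rw [hπℓ A hA]
      simpa only [hμA _ A hA] using hℓ A hA
  have hinv : π.bind κ = π := by
    ext A hA
    rw [← measureReal_eq_measureReal_iff]
    have hAm : Measurable (A.indicator fun _ => (1 : ℝ)) := measurable_const.indicator hA
    have h1 : (π.bind κ).real A = ∫ x, kernelAvg κ (A.indicator fun _ => (1 : ℝ)) x ∂π := by
      rw [← integral_bind_kernel κ π hAm (hind A)]
      exact (integral_indicator_one hA).symm
    rw [h1]
    have h2 := tendsto_integral_of_tendsto_measureReal hset
      (φ := kernelAvg κ (A.indicator fun _ => (1 : ℝ))) (measurable_kernelAvg hAm)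
      (fun x => integral_nonneg fun y => indicator_nonneg (fun _ _ => zero_le_one) y)
      (fun x => (le_abs_self _).trans (abs_kernelAvg_le (hind A) x))
    refine tendsto_nhds_unique h2 ?_
    have h3 := (tendsto_add_atTop_iff_nat 1).2 (hset A hA)
    refine h3.congr fun n => ?_
    rw [hμA _ A hA, hμint n _ 1 (measurable_kernelAvg hAm) (abs_kernelAvg_le (hind A)),
      Function.iterate_succ_apply]
  refine ⟨π, hπp, hinv, fun π' hπ'p hπ' => ?_, fun φ B hφ hB n x => ?_⟩
  · ext A hA
    rw [← measureReal_eq_measureReal_iff]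
    have hAm : Measurable (A.indicator fun _ => (1 : ℝ)) := measurable_const.indicator hA
    have h1 := tendsto_iterate_of_invariant hr hdecay hπ' hAm (hind A) x₀
    have h2 := tendsto_iterate_of_invariant hr hdecay hinv hAm (hind A) x₀
    have := tendsto_nhds_unique h1 h2
    rwa [← Pi.one_def, integral_indicator_one hA, integral_indicator_one hA] at this
  · exact dist_le_of_le_geometric_of_tendsto r _ hr.2 (hstep φ B hφ hB x)
      (tendsto_iterate_of_invariant hr hdecay hinv hφ hB x) n

end Ergodic

section Convolution

variable {d : ℕ}

lemma convPow_succ_eq_conv (μ : Measure (Ed d)) (n : ℕ) :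
    convPow d μ (n + 1) = (convPow d μ n).conv μ := rfl

instance convPow_isProbabilityMeasure (μ : Measure (Ed d)) [IsProbabilityMeasure μ] (n : ℕ) :
    IsProbabilityMeasure (convPow d μ n) := by
  induction n with
  | zero => exact inferInstanceAs (IsProbabilityMeasure (Measure.dirac 0))
  | succ n ih => rw [convPow_succ_eq_conv]; infer_instance

lemma convPow_add (μ : Measure (Ed d)) [IsProbabilityMeasure μ] (m n : ℕ) :
    convPow d μ (m + n) = (convPow d μ m).conv (convPow d μ n) := by
  induction n with
  | zero => exact (Measure.conv_dirac_zero _).symm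
  | succ n ih => rw [← add_assoc, convPow_succ_eq_conv, convPow_succ_eq_conv, ih,
      Measure.conv_assoc]

lemma convPow_one (μ : Measure (Ed d)) [IsProbabilityMeasure μ] : convPow d μ 1 = μ :=
  Measure.dirac_zero_conv μ

lemma conv_mono {μ μ' ν ν' : Measure (Ed d)} [SFinite ν] [SFinite ν'] (h : μ ≤ μ') (h' : ν ≤ ν') :
    μ.conv ν ≤ μ'.conv ν' :=
  Measure.map_mono (Measure.prod_mono h h') (by fun_prop)

lemma conv_restrict_volume_apply {K₁ K₂ A : Set (Ed d)} (h₁ : MeasurableSet K₁)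
    (h₂ : MeasurableSet K₂) (hA : MeasurableSet A) :
    ((volume.restrict K₁).conv (volume.restrict K₂)) A =
      ∫⁻ x in A, volume (K₁ ∩ {u | x - u ∈ K₂}) := by
  have hF : Measurable fun p : Ed d × Ed d => K₁.indicator (1 : Ed d → ℝ≥0∞) p.1 *
      (K₂.indicator (1 : Ed d → ℝ≥0∞) (p.2 - p.1) * A.indicator (1 : Ed d → ℝ≥0∞) p.2) := by
    have m₁ := (measurable_one (α := ℝ≥0∞)).indicator h₁
    have m₂ := (measurable_one (α := ℝ≥0∞)).indicator h₂
    have m₃ := (measurable_one (α := ℝ≥0∞)).indicator hA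
    exact (m₁.comp measurable_fst).mul
      ((m₂.comp (measurable_snd.sub measurable_fst)).mul (m₃.comp measurable_snd))
  calc ((volume.restrict K₁).conv (volume.restrict K₂)) A
      = ∫⁻ u in K₁, ∫⁻ v in K₂, A.indicator 1 (u + v) := by
        rw [← lintegral_indicator_one hA, Measure.lintegral_conv (measurable_one.indicator hA)]
    _ = ∫⁻ u, ∫⁻ x, K₁.indicator 1 u * (K₂.indicator 1 (x - u) * A.indicator 1 x) := by
        rw [← lintegral_indicator h₁]
        refine lintegral_congr fun u => ?_
        by_cases hu : u ∈ K₁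
        · simp only [indicator_of_mem hu, Pi.one_apply, one_mul]
          rw [← lintegral_indicator h₂, ← lintegral_sub_right_eq_self _ u]
          refine lintegral_congr fun x => ?_
          by_cases hx : x - u ∈ K₂ <;> simp [hx]
        · simp [hu]
    _ = ∫⁻ x, ∫⁻ u, K₁.indicator 1 u * (K₂.indicator 1 (x - u) * A.indicator 1 x) :=
        lintegral_lintegral_swap hF.aemeasurable
    _ = ∫⁻ x in A, volume (K₁ ∩ {u | x - u ∈ K₂}) := by
        rw [← lintegral_indicator hA]
        refine lintegral_congr fun x => ?_
        have hm : MeasurableSet (K₁ ∩ {u | x - u ∈ K₂}) :=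
          h₁.inter (measurable_const.sub measurable_id h₂)
        by_cases hx : x ∈ A
        · simp only [indicator_of_mem hx]
          rw [← lintegral_indicator_one hm]
          refine lintegral_congr fun u => ?_
          by_cases hu : u ∈ K₁ <;> by_cases hv : x - u ∈ K₂ <;> simp [hu, hv]
        · simp [hx]

/-- `ν` dominates a positive multiple of Lebesgue measure on the ball of centre `x` and
radius `r`. -/
def DominatesBall (ν : Measure (Ed d)) (x : Ed d) (r : ℝ) : Prop :=
  ∃ c : ℝ≥0∞, c ≠ 0 ∧ c • volume.restrict (Metric.ball x r) ≤ ν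

lemma DominatesBall.mono {ν : Measure (Ed d)} {x y : Ed d} {r s : ℝ} (h : DominatesBall ν x r)
    (hs : Metric.ball y s ⊆ Metric.ball x r) : DominatesBall ν y s := by
  obtain ⟨c, hc, hle⟩ := h
  refine ⟨c, hc, le_trans ?_ hle⟩
  gcongr

lemma DominatesBall.pos {ν : Measure (Ed d)} {x : Ed d} {r : ℝ} (hr : 0 < r)
    (h : DominatesBall ν x r) : 0 < ν (Metric.ball x r) := by
  obtain ⟨c, hc, hle⟩ := h
  refine lt_of_lt_of_le ?_ (hle _)
  simpa [pos_iff_ne_zero, hc] using (Metric.measure_ball_pos volume x hr).ne'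

lemma dominatesBall_conv {ν₁ ν₂ : Measure (Ed d)} [SFinite ν₂] {c₁ c₂ η : ℝ≥0∞}
    {K₁ K₂ : Set (Ed d)} {x₀ : Ed d} {r : ℝ} (h₁ : MeasurableSet K₁) (h₂ : MeasurableSet K₂)
    (hc₁ : c₁ ≠ 0) (hc₂ : c₂ ≠ 0) (hη : η ≠ 0) (hν₁ : c₁ • volume.restrict K₁ ≤ ν₁)
    (hν₂ : c₂ • volume.restrict K₂ ≤ ν₂)
    (h : ∀ x ∈ Metric.ball x₀ r, η ≤ volume (K₁ ∩ {u | x - u ∈ K₂})) :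
    DominatesBall (ν₁.conv ν₂) x₀ r := by
  refine ⟨c₁ * c₂ * η, by simp [*], Measure.le_iff.2 fun A hA => ?_⟩
  have h3 : (c₁ * c₂) • ((volume.restrict K₁).conv (volume.restrict K₂)) ≤ ν₁.conv ν₂ := by
    have h4 := conv_mono hν₁ hν₂
    have h5 : (c₁ • volume.restrict K₁).conv (c₂ • volume.restrict K₂) =
        (c₁ * c₂) • ((volume.restrict K₁).conv (volume.restrict K₂)) := by
      simp only [Measure.conv]
      rw [Measure.prod_smul_left, Measure.prod_smul_right, Measure.map_smul, Measure.map_smul,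
        smul_smul]
    rwa [h5] at h4
  refine le_trans ?_ (h3 A)
  rw [Measure.smul_apply, Measure.smul_apply, smul_eq_mul, smul_eq_mul, mul_assoc,
    conv_restrict_volume_apply h₁ h₂ hA, Measure.restrict_apply hA]
  gcongr
  calc η * volume (A ∩ Metric.ball x₀ r) = ∫⁻ x in A ∩ Metric.ball x₀ r, η := by simp
    _ ≤ ∫⁻ x in A ∩ Metric.ball x₀ r, volume (K₁ ∩ {u | x - u ∈ K₂}) :=
        setLIntegral_mono' (hA.inter Metric.isOpen_ball.measurableSet) fun x hx => h x hx.2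
    _ ≤ _ := lintegral_mono_set inter_subset_left

lemma DominatesBall.conv_self {ν : Measure (Ed d)} [SFinite ν] {r : ℝ} (hr : 0 < r)
    (h : DominatesBall ν 0 r) : DominatesBall (ν.conv ν) 0 (3 / 2 * r) := by
  obtain ⟨c, hc, hle⟩ := h
  refine dominatesBall_conv (η := volume (Metric.ball (0 : Ed d) (r / 4)))
    Metric.isOpen_ball.measurableSet Metric.isOpen_ball.measurableSet hc hc
    (Metric.measure_ball_pos volume _ (by positivity)).ne' hle hle fun x hx => ?_
  have e : volume (Metric.ball (0 : Ed d) (r / 4)) =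
      volume (Metric.ball ((1 / 2 : ℝ) • x) (r / 4)) := by
    rw [Measure.addHaar_ball_center volume ((1 / 2 : ℝ) • x)]
  rw [e]
  have hx' : ‖(1 / 2 : ℝ) • x‖ < 3 / 4 * r := by
    rw [norm_smul]
    rw [mem_ball_zero_iff] at hx
    norm_num
    linarith
  refine measure_mono fun u hu => ?_
  rw [mem_ball_iff_norm] at hu
  have e2 : x - u = (1 / 2 : ℝ) • x - (u - (1 / 2 : ℝ) • x) := by module
  have e3 : u = (1 / 2 : ℝ) • x + (u - (1 / 2 : ℝ) • x) := by module
  refine ⟨?_, ?_⟩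
  · rw [mem_ball_zero_iff, e3]
    refine (norm_add_le _ _).trans_lt ?_
    linarith
  · change x - u ∈ Metric.ball (0 : Ed d) r
    rw [mem_ball_zero_iff, e2]
    refine (norm_sub_le _ _).trans_lt ?_
    linarith

lemma DominatesBall.conv_of_mem_support {ν η : Measure (Ed d)} [SFinite ν] [SFinite η]
    {x y : Ed d} {r : ℝ} (hr : 0 < r) (h : DominatesBall ν x r) (hy : y ∈ η.support) :
    DominatesBall (ν.conv η) (x + y) (r / 2) := by
  obtain ⟨c, hc, hle⟩ := h
  have hpos : 0 < η (Metric.ball y (r / 2)) :=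
    (Measure.mem_support_iff_forall y).1 hy _ (Metric.ball_mem_nhds y (by positivity))
  refine ⟨c * η (Metric.ball y (r / 2)), mul_ne_zero hc hpos.ne', Measure.le_iff.2 fun A hA => ?_⟩
  rw [Measure.smul_apply, smul_eq_mul, Measure.restrict_apply hA, Measure.conv_comm,
    ← lintegral_indicator_one hA, Measure.lintegral_conv (measurable_one.indicator hA)]
  calc c * η (Metric.ball y (r / 2)) * volume (A ∩ Metric.ball (x + y) (r / 2))
      = ∫⁻ _ in Metric.ball y (r / 2), c * volume (A ∩ Metric.ball (x + y) (r / 2)) ∂η := by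
        simp; ring
    _ ≤ ∫⁻ v in Metric.ball y (r / 2), ∫⁻ u, A.indicator 1 (v + u) ∂ν ∂η := by
        refine setLIntegral_mono' Metric.isOpen_ball.measurableSet fun v hv => ?_
        have hm : MeasurableSet ((fun u => v + u) ⁻¹' A) := measurable_const_add v hA
        have e : ∫⁻ u, A.indicator 1 (v + u) ∂ν = ν ((fun u => v + u) ⁻¹' A) := by
          rw [← lintegral_indicator_one hm]; rfl
        rw [e]
        refine le_trans ?_ (hle _)
        rw [Measure.smul_apply, smul_eq_mul, Measure.restrict_apply hm]
        refine mul_le_mul_right ?_ c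
        rw [← measure_preimage_add volume v]
        refine measure_mono fun u hu => ⟨hu.1, ?_⟩
        have h1 := hu.2
        rw [mem_ball_iff_norm] at h1 hv ⊢
        have : u - x = (v + u - (x + y)) - (v - y) := by abel
        rw [this]
        refine (norm_sub_le _ _).trans_lt ?_
        linarith
    _ ≤ _ := setLIntegral_le_lintegral _ _

lemma add_mem_support_conv {ν η : Measure (Ed d)} [SFinite ν] [SFinite η] {x y : Ed d}
    (hx : x ∈ ν.support) (hy : y ∈ η.support) : x + y ∈ (ν.conv η).support := by
  rw [Measure.mem_support_iff_forall] at *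
  intro U hU
  obtain ⟨s, hs, hsU⟩ := Metric.mem_nhds_iff.1 hU
  have h1 := hx _ (Metric.ball_mem_nhds x (half_pos hs))
  have h2 := hy _ (Metric.ball_mem_nhds y (half_pos hs))
  refine lt_of_lt_of_le ?_ (measure_mono hsU)
  rw [Measure.conv, Measure.map_apply (by fun_prop) Metric.isOpen_ball.measurableSet]
  refine lt_of_lt_of_le (ENNReal.mul_pos h1.ne' h2.ne') ?_
  rw [← Measure.prod_prod]
  refine measure_mono fun p hp => ?_
  have a1 := hp.1
  have a2 := hp.2
  change p.1 + p.2 ∈ Metric.ball (x + y) s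
  rw [mem_ball_iff_norm] at *
  rw [add_sub_add_comm]
  refine (norm_add_le _ _).trans_lt ?_
  linarith

/-- The points reachable by the random walk with step distribution `μ`. -/
def reachable (μ : Measure (Ed d)) [IsProbabilityMeasure μ] : AddSubmonoid (Ed d) where
  carrier := {z | ∃ n, z ∈ (convPow d μ n).support}
  zero_mem' := ⟨0, by
    rw [Measure.mem_support_iff_forall]
    intro U hU
    have : (1 : ℝ≥0∞) ≤ Measure.dirac (0 : Ed d) U := by
      refine le_trans ?_ Measure.le_dirac_apply
      simp [mem_of_mem_nhds hU]
    exact lt_of_lt_of_le one_pos this⟩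
  add_mem' := by
    rintro x y ⟨m, hm⟩ ⟨n, hn⟩
    exact ⟨m + n, by rw [convPow_add]; exact add_mem_support_conv hm hn⟩

end Convolution

section SpreadOut

variable {d : ℕ}

lemma exists_smul_restrict_le_of_spreadOut {μ : Measure (Ed d)} (h : SpreadOut d μ) :
    ∃ k, 0 < k ∧ ∃ c : ℝ≥0∞, c ≠ 0 ∧ ∃ K : Set (Ed d), IsCompact K ∧ volume K ≠ 0 ∧
      c • volume.restrict K ≤ convPow d μ k := by
  obtain ⟨k, hk, f, hf, hf0, hpos, hle⟩ := h
  have hintg : Integrable f := by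
    by_contra hn
    rw [integral_undef hn] at hpos
    exact lt_irrefl _ hpos
  have hsupp : 0 < volume (Function.support f) :=
    (integral_pos_iff_support_of_nonneg hf0 hintg).1 hpos
  have hU : Function.support f = ⋃ n : ℕ, {x | 1 / ((n : ℝ) + 1) ≤ f x} := by
    ext x
    simp only [Function.mem_support, mem_iUnion, mem_ofPred_eq]
    constructor
    · intro hx
      obtain ⟨n, hn⟩ := exists_nat_one_div_lt (lt_of_le_of_ne (hf0 x) (Ne.symm hx))
      exact ⟨n, hn.le⟩
    · rintro ⟨n, hn⟩
      exact (lt_of_lt_of_le (by positivity) hn).ne'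
  rw [hU] at hsupp
  obtain ⟨n, hn⟩ : ∃ n : ℕ, volume {x | 1 / ((n : ℝ) + 1) ≤ f x} ≠ 0 := by
    by_contra! hn
    exact hsupp.ne' (measure_iUnion_null hn)
  have hmeas : MeasurableSet {x | 1 / ((n : ℝ) + 1) ≤ f x} :=
    measurableSet_le measurable_const hf
  obtain ⟨K, hKs, hK, hKpos⟩ := hmeas.exists_lt_isCompact (pos_iff_ne_zero.2 hn)
  refine ⟨k, hk, ENNReal.ofReal (1 / ((n : ℝ) + 1)), ?_, K, hK, hKpos.ne', ?_⟩
  · rw [Ne, ENNReal.ofReal_eq_zero, not_le]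
    positivity
  refine Measure.le_iff.2 fun A hA => le_trans ?_ (hle A hA)
  rw [Measure.smul_apply, smul_eq_mul, Measure.restrict_apply hA,
    ofReal_integral_eq_lintegral_ofReal hintg.integrableOn (ae_of_all _ hf0)]
  calc _ = ∫⁻ _ in A ∩ K, ENNReal.ofReal (1 / ((n : ℝ) + 1)) := by simp
    _ ≤ ∫⁻ x in A ∩ K, ENNReal.ofReal (f x) :=
        setLIntegral_mono' (hA.inter hK.measurableSet) fun x hx =>
          ENNReal.ofReal_le_ofReal (hKs hx.2)
    _ ≤ _ := lintegral_mono_set inter_subset_left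

open scoped Pointwise in
lemma exists_dominatesBall_of_smul_restrict_le {ν : Measure (Ed d)} [SFinite ν] {c : ℝ≥0∞}
    (hc : c ≠ 0) {K : Set (Ed d)} (hK : IsCompact K) (hK0 : volume K ≠ 0)
    (hle : c • volume.restrict K ≤ ν) :
    ∃ x, ∃ r > 0, DominatesBall (ν.conv ν) x r := by
  obtain ⟨x₀, hx₀⟩ : ∃ x : Ed d, volume (K ∩ {u | x - u ∈ K}) ≠ 0 := by
    by_contra! hn
    have h1 := conv_restrict_volume_apply (A := univ) hK.measurableSet hK.measurableSet
      MeasurableSet.univ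
    simp only [hn, lintegral_const, zero_mul] at h1
    rw [Measure.conv, Measure.map_apply (by fun_prop) MeasurableSet.univ, preimage_univ,
      ← univ_prod_univ, Measure.prod_prod] at h1
    simp [hK0] at h1
  set K₁ : Set (Ed d) := K ∩ {u | x₀ - u ∈ K} with hK₁
  have hcl : IsClosed {u : Ed d | x₀ - u ∈ K} :=
    hK.isClosed.preimage (continuous_const.sub continuous_id)
  have hcomp : IsCompact K₁ := hK.inter_right hcl
  have hη : volume K₁ / 2 ≠ 0 := by simp [hx₀]
  have ht := tendsto_measure_vadd_sdiff_isCompact_isClosed (μ := (volume : Measure (Ed d)))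
    hcomp hcomp.isClosed
  have ht' := (ENNReal.tendsto_nhds_zero.1 ht) (volume K₁ / 2) (pos_iff_ne_zero.2 hη)
  obtain ⟨r, hr, hball⟩ := Metric.eventually_nhds_iff_ball.1 ht'
  refine ⟨x₀, r, hr, ?_⟩
  have hle₁ : c • volume.restrict K₁ ≤ ν := by
    refine le_trans ?_ hle
    gcongr
    exact inter_subset_left
  refine dominatesBall_conv hcomp.measurableSet hcomp.measurableSet hc hc hη hle₁ hle₁
    fun x hx => ?_
  have h2 := hball (x - x₀) (by rw [mem_ball_zero_iff]; rwa [mem_ball_iff_norm] at hx)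
  have h3 : ((x - x₀) +ᵥ K₁) ∩ K₁ ⊆ K₁ ∩ {u | x - u ∈ K₁} := by
    rintro u ⟨⟨w, hw, rfl⟩, hu⟩
    refine ⟨hu, ?_⟩
    have e : x - ((x - x₀) + w) = x₀ - w := by abel
    change x - ((x - x₀) + w) ∈ K₁
    rw [e]
    exact ⟨hw.2, by simpa using hw.1⟩
  have h4 : volume K₁ ≤ volume (K₁ ∩ {u | x - u ∈ K₁}) + volume K₁ / 2 := by
    calc volume K₁ = volume ((x - x₀) +ᵥ K₁) := (measure_vadd volume _ _).symm
      _ ≤ volume (((x - x₀) +ᵥ K₁) ∩ K₁) + volume (((x - x₀) +ᵥ K₁) \ K₁) :=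
        measure_le_inter_add_sdiff _ _ _
      _ ≤ _ := add_le_add (measure_mono h3) h2
  have hfin : volume K₁ / 2 ≠ ⊤ := ENNReal.div_ne_top hcomp.measure_lt_top.ne (by simp)
  have h5 : volume K₁ / 2 + volume K₁ / 2 ≤
      volume (K₁ ∩ {u | x - u ∈ K₁}) + volume K₁ / 2 := by rwa [ENNReal.add_halves]
  exact (ENNReal.add_le_add_iff_right hfin).1 h5

lemma exists_dominatesBall_of_spreadOut {μ : Measure (Ed d)} [IsProbabilityMeasure μ]
    (h : SpreadOut d μ) :
    ∃ k, 0 < k ∧ ∃ x, ∃ r > 0, DominatesBall (convPow d μ k) x r := by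
  obtain ⟨k, hk, c, hc, K, hK, hK0, hle⟩ := exists_smul_restrict_le_of_spreadOut h
  obtain ⟨x, r, hr, hx⟩ := exists_dominatesBall_of_smul_restrict_le hc hK hK0 hle
  exact ⟨k + k, by omega, x, r, hr, by rwa [convPow_add]⟩

lemma ae_convPow {μ : Measure (Ed d)} [IsProbabilityMeasure μ] {S : AddSubmonoid (Ed d)}
    (hS : MeasurableSet (S : Set (Ed d))) (h : ∀ᵐ y ∂μ, y ∈ S) (n : ℕ) :
    ∀ᵐ y ∂(convPow d μ n), y ∈ S := by
  induction n with
  | zero =>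
    change ∀ᵐ y ∂(Measure.dirac 0), y ∈ S
    rw [ae_dirac_iff (p := (· ∈ S)) hS]
    exact S.zero_mem
  | succ n ih =>
    rw [convPow_succ_eq_conv, Measure.conv, ae_map_iff (p := (· ∈ S)) (by fun_prop) hS]
    filter_upwards [Measure.quasiMeasurePreserving_fst.ae ih,
      Measure.quasiMeasurePreserving_snd.ae h] with p h1 h2 using S.add_mem h1 h2

lemma neg_smul_mem_of_isClosed {H : AddSubmonoid (Ed d)} (hH : IsClosed (H : Set (Ed d)))
    {s t : ℝ} (hs : 0 < s) (ht : 0 < t) {v : Ed d} (h1 : s • v ∈ H) (h2 : (-t) • v ∈ H) :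
    -(s • v) ∈ H := by
  have key : -(s • v) ∈ closure (H : Set (Ed d)) := by
    rw [Metric.mem_closure_iff]
    intro δ hδ
    obtain ⟨n, hn⟩ := exists_nat_gt (t * ‖v‖ / δ)
    have hn0 : 0 < n + 1 := Nat.succ_pos n
    obtain ⟨j, k, hk0, hkn, hjk⟩ := Real.exists_int_int_abs_mul_sub_le (s / t) hn0
    have hj0 : 0 ≤ j := by
      by_contra hj
      have : (j : ℝ) ≤ -1 := by exact_mod_cast Int.le_sub_one_of_lt (not_le.1 hj)
      have h3 : 0 < (k : ℝ) * (s / t) := by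
        have : (0 : ℝ) < k := by exact_mod_cast hk0
        positivity
      have h4 : 1 / (((n + 1 : ℕ) : ℝ) + 1) < 1 := by
        rw [div_lt_one (by positivity)]
        push_cast
        linarith [Nat.cast_nonneg (α := ℝ) n]
      rw [abs_le] at hjk
      linarith [hjk.2]
    lift j to ℕ using hj0
    obtain ⟨a, ha⟩ : ∃ a : ℕ, k = a + 1 := ⟨(k - 1).toNat, by omega⟩
    subst ha
    refine ⟨a • (s • v) + j • ((-t) • v), H.add_mem (H.nsmul_mem h1 a) (H.nsmul_mem h2 j), ?_⟩
    rw [dist_eq_norm]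
    have e : -(s • v) - (a • (s • v) + j • ((-t) • v)) =
        (-(t * ((((a : ℝ) + 1)) * (s / t) - j))) • v := by
      have : t * (((a : ℝ) + 1) * (s / t) - j) = ((a : ℝ) + 1) * s - t * j := by
        field_simp
      rw [this, ← Nat.cast_smul_eq_nsmul ℝ, ← Nat.cast_smul_eq_nsmul ℝ]
      module
    push_cast at hjk
    rw [e, norm_smul, norm_neg, norm_mul, Real.norm_eq_abs, Real.norm_eq_abs, abs_of_pos ht]
    have h5 : t * ‖v‖ < δ * (n + 1 + 1) := by
      rw [div_lt_iff₀ hδ] at hn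
      nlinarith
    calc t * |((a : ℝ) + 1) * (s / t) - j| * ‖v‖
        ≤ t * (1 / (n + 1 + 1)) * ‖v‖ := by gcongr
      _ = t * ‖v‖ / (n + 1 + 1) := by ring
      _ < δ := by rwa [div_lt_iff₀ (by positivity)]
  rwa [hH.closure_eq] at key

end SpreadOut

section Mixture

variable {d : ℕ} {ρ : ℝ} {Γ : Measure (Ed d)}

lemma isProbabilityMeasure_mixMeasure [IsProbabilityMeasure Γ] (hρ : ρ ∈ Ioo (0 : ℝ) 1) :
    IsProbabilityMeasure (mixMeasure d ρ Γ) := by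
  refine ⟨?_⟩
  rw [mixMeasure, Measure.add_apply, Measure.smul_apply, Measure.smul_apply,
    Measure.map_apply (by fun_prop) MeasurableSet.univ,
    Measure.map_apply (by fun_prop) MeasurableSet.univ, preimage_univ, preimage_univ,
    measure_univ, smul_eq_mul, smul_eq_mul, mul_one, mul_one,
    ← ENNReal.ofReal_add hρ.1.le (by linarith [hρ.2])]
  simp

lemma ae_mixMeasure {p : Ed d → Prop} (hp : MeasurableSet {x | p x})
    (h : ∀ᵐ x ∂Γ, p ((1 - ρ) • x) ∧ p ((-ρ) • x)) : ∀ᵐ y ∂(mixMeasure d ρ Γ), p y := by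
  rw [mixMeasure, ae_add_measure_iff]
  constructor
  · refine Measure.ae_smul_measure ?_ _
    rw [ae_map_iff (by fun_prop) hp]
    exact h.mono fun x hx => hx.1
  · refine Measure.ae_smul_measure ?_ _
    rw [ae_map_iff (by fun_prop) hp]
    exact h.mono fun x hx => hx.2

lemma mem_support_smul_map {c : ℝ≥0∞} (hc : c ≠ 0) (a : ℝ) {x : Ed d} (hx : x ∈ Γ.support) :
    a • x ∈ (c • Γ.map (fun x => a • x)).support := by
  rw [Measure.mem_support_iff_forall] at *
  intro U hU
  obtain ⟨V, hVU, hV, hxV⟩ := mem_nhds_iff.1 hU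
  have h1 := hx ((fun x => a • x) ⁻¹' V)
    ((hV.preimage (continuous_const_smul a)).mem_nhds hxV)
  refine lt_of_lt_of_le ?_ (measure_mono hVU)
  rw [Measure.smul_apply, Measure.map_apply (by fun_prop) hV.measurableSet]
  exact ENNReal.mul_pos hc h1.ne'

lemma smul_mem_support_mixMeasure (hρ : ρ ∈ Ioo (0 : ℝ) 1) {x : Ed d} (hx : x ∈ Γ.support) :
    (1 - ρ) • x ∈ (mixMeasure d ρ Γ).support ∧ (-ρ) • x ∈ (mixMeasure d ρ Γ).support := by
  rw [mixMeasure, Measure.support_add]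
  refine ⟨Or.inl (mem_support_smul_map ?_ _ hx), Or.inr (mem_support_smul_map ?_ _ hx)⟩
  · simpa using hρ.1
  · simpa using hρ.2

lemma suppSpan_eq_span_support : suppSpan d Γ = Submodule.span ℝ Γ.support := by
  rw [suppSpan, Measure.support_eq_forall_isOpen]
  congr 1
  ext x
  exact ⟨fun h U hx hU => h U hU hx, fun h U hU hx => h U hx hU⟩

lemma suppSpan_eq_top [IsProbabilityMeasure Γ] (hρ : ρ ∈ Ioo (0 : ℝ) 1)
    (h : SpreadOut d (mixMeasure d ρ Γ)) : suppSpan d Γ = ⊤ := by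
  have := isProbabilityMeasure_mixMeasure (d := d) (Γ := Γ) hρ
  by_contra hne
  have hcl : IsClosed (suppSpan d Γ : Set (Ed d)) := Submodule.closed_of_finiteDimensional _
  have hΓ : ∀ᵐ x ∂Γ, x ∈ suppSpan d Γ := by
    filter_upwards [Measure.support_mem_ae] with x hx
    rw [suppSpan_eq_span_support]
    exact Submodule.subset_span hx
  have hmix : ∀ᵐ y ∂(mixMeasure d ρ Γ), y ∈ (suppSpan d Γ).toAddSubmonoid :=
    ae_mixMeasure hcl.measurableSet (hΓ.mono fun x hx =>
      ⟨(suppSpan d Γ).smul_mem _ hx, (suppSpan d Γ).smul_mem _ hx⟩)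
  obtain ⟨k, -, c, hc, K, hK, hK0, hle⟩ := exists_smul_restrict_le_of_spreadOut h
  have h1 := ae_convPow hcl.measurableSet hmix k
  rw [ae_iff] at h1
  have h2 : (c • volume.restrict K) {y | y ∉ suppSpan d Γ} = 0 :=
    le_antisymm ((hle _).trans h1.le) zero_le
  rw [Measure.smul_apply, smul_eq_mul, mul_eq_zero,
    Measure.restrict_apply (show MeasurableSet {y | y ∉ suppSpan d Γ} from
      hcl.measurableSet.compl)] at h2
  refine hK0 (le_antisymm ?_ zero_le)
  calc volume K ≤ volume ({y | y ∉ suppSpan d Γ} ∩ K ∪ (suppSpan d Γ : Set (Ed d))) :=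
        measure_mono fun x hx => by
          by_cases hxs : x ∈ suppSpan d Γ
          · exact Or.inr hxs
          · exact Or.inl ⟨hxs, hx⟩
    _ ≤ _ := measure_union_le _ _
    _ = 0 := by rw [h2.resolve_left hc, Measure.addHaar_submodule volume _ hne, add_zero]

lemma exists_dominatesBall_zero [IsProbabilityMeasure Γ] (hρ : ρ ∈ Ioo (0 : ℝ) 1)
    (h : SpreadOut d (mixMeasure d ρ Γ)) :
    ∃ k, 0 < k ∧ ∃ r > 0, DominatesBall (convPow d (mixMeasure d ρ Γ) k) 0 r := by
  have := isProbabilityMeasure_mixMeasure (d := d) (Γ := Γ) hρ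
  set μ := mixMeasure d ρ Γ with hμ
  obtain ⟨k, hk, x, r, hr, hx⟩ := exists_dominatesBall_of_spreadOut h
  set H := (reachable μ).topologicalClosure with hH
  have hHcl : IsClosed (H : Set (Ed d)) := (reachable μ).isClosed_topologicalClosure
  have hmem : ∀ y ∈ μ.support, y ∈ H := fun y hy =>
    (reachable μ).le_topologicalClosure ⟨1, by rwa [convPow_one]⟩
  have hneg : ∀ᵐ y ∂μ, y ∈ H.comap (negAddMonoidHom : Ed d →+ Ed d) := by
    refine ae_mixMeasure (hHcl.preimage continuous_neg).measurableSet ?_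
    filter_upwards [Measure.support_mem_ae (μ := Γ)] with v hv
    obtain ⟨h1, h2⟩ := smul_mem_support_mixMeasure hρ hv
    have h3 := hmem _ h1
    have h4 := hmem _ h2
    refine ⟨neg_smul_mem_of_isClosed hHcl (by linarith [hρ.2]) hρ.1 h3 h4, ?_⟩
    have h5 := neg_smul_mem_of_isClosed hHcl (v := -v) hρ.1 (by linarith [hρ.2] : 0 < 1 - ρ)
      (by simpa using h4) (by rwa [neg_smul_neg])
    change -((-ρ) • v) ∈ H
    simpa using h5
  have hneg' := ae_convPow (hHcl.preimage continuous_neg).measurableSet hneg k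
  have hpos := (hx.mono (Metric.ball_subset_ball (half_le_self hr.le))).pos (half_pos hr)
  obtain ⟨y, hyH, hy⟩ : ∃ y, -y ∈ H ∧ y ∈ Metric.ball x (r / 2) := by
    by_contra! hn
    refine hpos.ne' (measure_mono_null (fun y hy hyH => hn y hyH hy) (ae_iff.1 hneg'))
  obtain ⟨z, ⟨n, hz⟩, hzy⟩ := Metric.mem_closure_iff.1 hyH (r / 8) (by positivity)
  refine ⟨k + n, by omega, r / 8, by positivity, ?_⟩
  rw [convPow_add]
  have h6 : DominatesBall (convPow d μ k) y (r / 2) := hx.mono fun w hw => by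
    rw [Metric.mem_ball] at *
    exact (dist_triangle w y x).trans_lt (by linarith)
  refine (h6.conv_of_mem_support (half_pos hr) hz).mono fun w hw => ?_
  rw [mem_ball_zero_iff] at hw
  rw [mem_ball_iff_norm]
  rw [dist_eq_norm] at hzy
  have e : w - (y + z) = w + (-y - z) := by abel
  rw [e]
  refine (norm_add_le _ _).trans_lt ?_
  linarith

lemma exists_dominatesBall_zero_of_radius [IsProbabilityMeasure Γ] (hρ : ρ ∈ Ioo (0 : ℝ) 1)
    (h : SpreadOut d (mixMeasure d ρ Γ)) (R : ℝ) :
    ∃ k, 0 < k ∧ DominatesBall (convPow d (mixMeasure d ρ Γ) k) 0 R := by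
  have := isProbabilityMeasure_mixMeasure (d := d) (Γ := Γ) hρ
  obtain ⟨k, hk, r, hr, h0⟩ := exists_dominatesBall_zero hρ h
  have key : ∀ n : ℕ, ∃ k, 0 < k ∧
      DominatesBall (convPow d (mixMeasure d ρ Γ) k) 0 ((3 / 2) ^ n * r) := by
    intro n
    induction n with
    | zero => exact ⟨k, hk, by simpa using h0⟩
    | succ n ih =>
      obtain ⟨j, hj, hj'⟩ := ih
      refine ⟨j + j, by omega, ?_⟩
      rw [convPow_add, pow_succ', mul_assoc]
      exact hj'.conv_self (by positivity)
  obtain ⟨n, hn⟩ := pow_unbounded_of_one_lt (R / r) (by norm_num : (1 : ℝ) < 3 / 2)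
  obtain ⟨j, hj, hj'⟩ := key n
  refine ⟨j, hj, hj'.mono (Metric.ball_subset_ball ?_)⟩
  rw [div_lt_iff₀ hr] at hn
  exact hn.le

end Mixture

section Minorization

variable {d : ℕ}

/-- The averaging operator of a kernel on `ℝ≥0∞`-valued functions. -/
def kernelLAvg (κ : Kernel (Ed d) (Ed d)) (φ : Ed d → ℝ≥0∞) (x : Ed d) : ℝ≥0∞ :=
  ∫⁻ y, φ y ∂κ x

lemma ofReal_iterate_kernelAvg {κ : Kernel (Ed d) (Ed d)} [IsMarkovKernel κ] {V : Ed d → ℝ}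
    {γ K : ℝ} (hop : IsDriftOp V γ K (kernelAvg κ)) (hI : ∀ x, Integrable V (κ x)) (n : ℕ)
    {φ : Ed d → ℝ} (hφ : DomBy V φ) (hφ0 : ∀ x, 0 ≤ φ x) (x : Ed d) :
    ENNReal.ofReal ((kernelAvg κ)^[n] φ x) =
      (kernelLAvg κ)^[n] (fun y => ENNReal.ofReal (φ y)) x := by
  induction n generalizing φ with
  | zero => rfl
  | succ n ih =>
    rw [Function.iterate_succ_apply, Function.iterate_succ_apply,
      ih (hop.dom hφ) (fun y => integral_nonneg hφ0)]
    refine congrFun (congrArg _ (funext fun y => ?_)) x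
    exact ofReal_integral_eq_lintegral_ofReal (hφ.integrable (hI y)) (ae_of_all _ hφ0)

lemma le_iterate_kernelLAvg {κ : Kernel (Ed d) (Ed d)} {μ : Measure (Ed d)}
    [IsProbabilityMeasure μ] {c : ℝ≥0∞}
    (h : ∀ ψ : Ed d → ℝ≥0∞, Measurable ψ → ∀ x, c * ∫⁻ y, ψ (x + y) ∂μ ≤ kernelLAvg κ ψ x)
    (n : ℕ) {ψ : Ed d → ℝ≥0∞} (hψ : Measurable ψ) (x : Ed d) :
    c ^ n * ∫⁻ y, ψ (x + y) ∂(convPow d μ n) ≤ (kernelLAvg κ)^[n] ψ x := by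
  induction n generalizing ψ with
  | zero =>
    have h1 : ∫⁻ y, ψ (x + y) ∂(convPow d μ 0) = ψ x := by
      rw [show convPow d μ 0 = Measure.dirac 0 from rfl,
        lintegral_dirac' (f := fun y => ψ (x + y)) _ (hψ.comp (measurable_const_add x)),
        add_zero]
    simp [h1]
  | succ n ih =>
    have hm : Measurable (kernelLAvg κ ψ) := hψ.lintegral_kernel
    rw [Function.iterate_succ_apply]
    refine le_trans ?_ (ih hm)
    rw [pow_succ, mul_assoc, convPow_succ_eq_conv,
      Measure.lintegral_conv (f := fun y => ψ (x + y)) (hψ.comp (measurable_const_add x))]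
    refine mul_le_mul_right ?_ _
    have h2 : Measurable fun y => ∫⁻ z, ψ (x + (y + z)) ∂μ :=
      Measurable.lintegral_prod_right' (f := fun p : Ed d × Ed d => ψ (x + (p.1 + p.2)))
        (hψ.comp (by fun_prop))
    rw [← lintegral_const_mul _ h2]
    refine lintegral_mono fun y => ?_
    simpa only [add_assoc] using h ψ hψ (x + y)

lemma le_lintegral_add_of_dominates {ν : Measure (Ed d)} {c : ℝ≥0∞} {R : ℝ}
    (hle : c • volume.restrict (Metric.ball (0 : Ed d) (2 * R)) ≤ ν) {ψ : Ed d → ℝ≥0∞}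
    (x : Ed d) (hx : ‖x‖ ≤ R) :
    c * ∫⁻ y in Metric.ball 0 R, ψ y ≤ ∫⁻ y, ψ (x + y) ∂ν := by
  refine le_trans ?_ (lintegral_mono' hle le_rfl)
  rw [lintegral_smul_measure, smul_eq_mul]
  refine mul_le_mul_right ?_ _
  rw [← lintegral_indicator Metric.isOpen_ball.measurableSet,
    ← lintegral_indicator Metric.isOpen_ball.measurableSet,
    ← lintegral_add_left_eq_self _ x]
  refine lintegral_mono fun y => ?_
  by_cases hy : x + y ∈ Metric.ball (0 : Ed d) R
  · have hy' : y ∈ Metric.ball (0 : Ed d) (2 * R) := by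
      rw [mem_ball_zero_iff] at *
      rw [show y = (x + y) - x by abel]
      refine (norm_sub_le _ _).trans_lt ?_
      linarith
    rw [indicator_of_mem hy, indicator_of_mem hy']
  · rw [indicator_of_notMem hy]
    exact zero_le

/-- The uniform distribution on a ball around the origin. -/
def unifBall (d : ℕ) (R : ℝ) : Measure (Ed d) :=
  (volume (Metric.ball (0 : Ed d) R))⁻¹ • volume.restrict (Metric.ball 0 R)

lemma isProbabilityMeasure_unifBall {R : ℝ} (hR : 0 < R) :
    IsProbabilityMeasure (unifBall d R) := by
  refine ⟨?_⟩
  rw [unifBall, Measure.smul_apply, Measure.restrict_apply_univ, smul_eq_mul,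
    ENNReal.inv_mul_cancel (Metric.measure_ball_pos volume _ hR).ne'
      measure_ball_lt_top.ne]

lemma integrable_unifBall {R : ℝ} (hR : 0 < R) {V : Ed d → ℝ} (hV : Continuous V) :
    Integrable V (unifBall d R) := by
  refine Integrable.smul_measure ?_ ?_
  · exact (hV.continuousOn.integrableOn_compact (isCompact_closedBall 0 R)).mono_set
      Metric.ball_subset_closedBall
  · exact ENNReal.inv_ne_top.2 (Metric.measure_ball_pos volume _ hR).ne'

lemma exists_minorization_const {μ : Measure (Ed d)} [IsProbabilityMeasure μ] {ι R : ℝ}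
    (hι : ι ∈ Ioc (0 : ℝ) 1) (hR : 0 < R) {N : ℕ}
    (hdom : DominatesBall (convPow d μ N) 0 (2 * R)) :
    ∃ ε ∈ Ioc (0 : ℝ) 1, ∀ (κ : Kernel (Ed d) (Ed d)) [IsMarkovKernel κ],
      (∀ ψ : Ed d → ℝ≥0∞, Measurable ψ → ∀ x,
        ENNReal.ofReal ι * ∫⁻ y, ψ (x + y) ∂μ ≤ kernelLAvg κ ψ x) →
      ∀ {V : Ed d → ℝ} {γ K : ℝ}, Continuous V → IsDriftOp V γ K (kernelAvg κ) →
      (∀ x, Integrable V (κ x)) → ∀ φ, DomBy V φ → (∀ x, 0 ≤ φ x) → ∀ x, ‖x‖ ≤ R →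
        ε * ∫ y, φ y ∂(unifBall d R) ≤ (kernelAvg κ)^[N] φ x := by
  obtain ⟨c, hc, hle⟩ := hdom
  set v := volume (Metric.ball (0 : Ed d) R) with hv
  have hv0 : v ≠ 0 := (Metric.measure_ball_pos volume _ hR).ne'
  have hvt : v ≠ ⊤ := measure_ball_lt_top.ne
  have hcv : c * v ≤ 1 := by
    have h1 := hle univ
    rw [measure_univ (μ := convPow d μ N), Measure.smul_apply, Measure.restrict_apply_univ,
      smul_eq_mul] at h1
    refine le_trans ?_ h1
    exact mul_le_mul_right (measure_mono (Metric.ball_subset_ball (by linarith))) c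
  have hι1 : ENNReal.ofReal ι ^ N ≤ 1 := pow_le_one₀ zero_le (by simpa using hι.2)
  have hι0 : ENNReal.ofReal ι ^ N ≠ 0 := pow_ne_zero _ (by simpa using hι.1)
  set e := ENNReal.ofReal ι ^ N * (c * v) with he
  have he1 : e ≤ 1 := mul_le_one' hι1 hcv
  have he0 : e ≠ 0 := mul_ne_zero hι0 (mul_ne_zero hc hv0)
  have het : e ≠ ⊤ := (he1.trans_lt ENNReal.one_lt_top).ne
  refine ⟨e.toReal, ⟨ENNReal.toReal_pos he0 het, ENNReal.toReal_le_of_le_ofReal zero_le_one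
    (by simpa using he1)⟩, ?_⟩
  intro κ _ hκ V γ K hV hop hI φ hφ hφ0 x hx
  have h0 : 0 ≤ (kernelAvg κ)^[N] φ x := by
    have : ∀ (n : ℕ) (y), 0 ≤ (kernelAvg κ)^[n] φ y := fun n => by
      induction n with
      | zero => exact hφ0
      | succ n ih =>
        intro y
        rw [Function.iterate_succ_apply']
        exact integral_nonneg ih
    exact this N x
  have hintg : Integrable φ (unifBall d R) := hφ.integrable (integrable_unifBall hR hV)
  rw [← ENNReal.ofReal_le_ofReal_iff h0, ENNReal.ofReal_mul ENNReal.toReal_nonneg,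
    ENNReal.ofReal_toReal het, ofReal_iterate_kernelAvg hop hI N hφ hφ0,
    ofReal_integral_eq_lintegral_ofReal hintg (ae_of_all _ hφ0)]
  refine le_trans ?_ (le_iterate_kernelLAvg hκ N hφ.1.ennreal_ofReal x)
  rw [he, mul_assoc]
  refine mul_le_mul_right ?_ _
  refine le_trans (le_of_eq ?_)
    (le_lintegral_add_of_dominates (ψ := fun y => ENNReal.ofReal (φ y)) hle x hx)
  rw [unifBall, lintegral_smul_measure, smul_eq_mul, mul_assoc, ← mul_assoc v,
    ENNReal.mul_inv_cancel hv0 hvt, one_mul]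

end Minorization

section Kernel

variable {d : ℕ} {ρ : ℝ} {Γ : Measure (Ed d)} {g : Ed d → Ed d → ℝ}

/-- The one-step law of the chain started at `x`. -/
def stepLaw (d : ℕ) (ρ : ℝ) (Γ : Measure (Ed d)) (g : Ed d → Ed d → ℝ) (x : Ed d) :
    Measure (Ed d) :=
  (Γ.withDensity fun X => ENNReal.ofReal (g x X)).map (fun X => x + (1 - ρ) • X) +
    (Γ.withDensity fun X => ENNReal.ofReal (1 - g x X)).map (fun X => x - ρ • X)

lemma lintegral_stepLaw (hg : Measurable (Function.uncurry g)) {φ : Ed d → ℝ≥0∞}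
    (hφ : Measurable φ) (x : Ed d) :
    ∫⁻ y, φ y ∂(stepLaw d ρ Γ g x) =
      ∫⁻ X, (ENNReal.ofReal (g x X) * φ (x + (1 - ρ) • X) +
        ENNReal.ofReal (1 - g x X) * φ (x - ρ • X)) ∂Γ := by
  have hgx : Measurable (g x) := hg.of_uncurry_left
  have hgx' : Measurable fun X => ENNReal.ofReal (1 - g x X) :=
    (measurable_const.sub hgx).ennreal_ofReal
  have m₁ : Measurable fun X => φ (x + (1 - ρ) • X) := hφ.comp (by fun_prop)
  have m₂ : Measurable fun X => φ (x - ρ • X) := hφ.comp (by fun_prop)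
  rw [stepLaw, lintegral_add_measure, lintegral_map hφ (by fun_prop),
    lintegral_map hφ (by fun_prop),
    lintegral_withDensity_eq_lintegral_mul _ hgx.ennreal_ofReal m₁,
    lintegral_withDensity_eq_lintegral_mul _ hgx' m₂,
    ← lintegral_add_left (hgx.ennreal_ofReal.mul m₁)]
  rfl

lemma measurable_stepLaw [IsProbabilityMeasure Γ] (hg : Measurable (Function.uncurry g)) :
    Measurable (stepLaw d ρ Γ g) := by
  refine Measure.measurable_of_measurable_coe _ fun s hs => ?_
  have h1 : Measurable (s.indicator (1 : Ed d → ℝ≥0∞)) := measurable_one.indicator hs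
  simp_rw [← lintegral_indicator_one hs, lintegral_stepLaw hg h1]
  refine Measurable.lintegral_prod_right' (f := fun p : Ed d × Ed d =>
    ENNReal.ofReal (g p.1 p.2) * s.indicator 1 (p.1 + (1 - ρ) • p.2) +
      ENNReal.ofReal (1 - g p.1 p.2) * s.indicator 1 (p.1 - ρ • p.2)) ?_
  exact (hg.ennreal_ofReal.mul (h1.comp (by fun_prop))).add
    ((measurable_const.sub hg).ennreal_ofReal.mul (h1.comp (by fun_prop)))

/-- The transition kernel of the chain. -/
def stepKernel (d : ℕ) (ρ : ℝ) (Γ : Measure (Ed d)) [IsProbabilityMeasure Γ]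
    (g : Ed d → Ed d → ℝ) (hg : Measurable (Function.uncurry g)) : Kernel (Ed d) (Ed d) where
  toFun := stepLaw d ρ Γ g
  measurable' := measurable_stepLaw hg

lemma stepKernel_apply [IsProbabilityMeasure Γ] (hg : Measurable (Function.uncurry g))
    (x : Ed d) : stepKernel d ρ Γ g hg x = stepLaw d ρ Γ g x := rfl

lemma isMarkovKernel_stepKernel [IsProbabilityMeasure Γ] (hg : Measurable (Function.uncurry g))
    (hg01 : ∀ x X, g x X ∈ Icc (0 : ℝ) 1) : IsMarkovKernel (stepKernel d ρ Γ g hg) := by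
  refine ⟨fun x => ⟨?_⟩⟩
  rw [stepKernel_apply, ← lintegral_one, lintegral_stepLaw hg measurable_const]
  have : ∀ X, ENNReal.ofReal (g x X) * 1 + ENNReal.ofReal (1 - g x X) * 1 = 1 := fun X => by
    rw [mul_one, mul_one, ← ENNReal.ofReal_add (hg01 x X).1 (by linarith [(hg01 x X).2])]
    simp
  simp only [this, lintegral_one, measure_univ]

lemma kernelOp_eq_integral_stepLaw (hg : Measurable (Function.uncurry g))
    (hg01 : ∀ x X, g x X ∈ Icc (0 : ℝ) 1) {φ : Ed d → ℝ} (hφ : Measurable φ) {x : Ed d}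
    (hi : Integrable φ (stepLaw d ρ Γ g x)) :
    kernelOp d ρ Γ g φ x = ∫ y, φ y ∂(stepLaw d ρ Γ g x) := by
  have hgx : Measurable (g x) := hg.of_uncurry_left
  have hgx' : Measurable fun X => ENNReal.ofReal (1 - g x X) :=
    (measurable_const.sub hgx).ennreal_ofReal
  rw [stepLaw] at hi ⊢
  have i₁ := hi.left_of_add_measure
  have i₂ := hi.right_of_add_measure
  rw [integral_add_measure i₁ i₂, integral_map (by fun_prop) hφ.aestronglyMeasurable,
    integral_map (by fun_prop) hφ.aestronglyMeasurable]
  rw [integrable_map_measure hφ.aestronglyMeasurable (by fun_prop),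
    integrable_withDensity_iff_integrable_smul' hgx.ennreal_ofReal (by simp)] at i₁
  rw [integrable_map_measure hφ.aestronglyMeasurable (by fun_prop),
    integrable_withDensity_iff_integrable_smul' hgx'
      (by simp)] at i₂
  rw [integral_withDensity_eq_integral_toReal_smul hgx.ennreal_ofReal (by simp),
    integral_withDensity_eq_integral_toReal_smul hgx'
      (by simp)]
  refine Eq.trans ?_ (integral_add i₁ i₂)
  refine integral_congr_ae (ae_of_all _ fun X => ?_)
  have h2 : 0 ≤ 1 - g x X := by linarith [(hg01 x X).2]
  simp [ENNReal.toReal_ofReal (hg01 x X).1, ENNReal.toReal_ofReal h2]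

lemma lintegral_mixMeasure {φ : Ed d → ℝ≥0∞}
    (hφ : Measurable φ) :
    ∫⁻ y, φ y ∂(mixMeasure d ρ Γ) = ENNReal.ofReal ρ * ∫⁻ X, φ ((1 - ρ) • X) ∂Γ +
      ENNReal.ofReal (1 - ρ) * ∫⁻ X, φ ((-ρ) • X) ∂Γ := by
  rw [mixMeasure, lintegral_add_measure, lintegral_smul_measure, lintegral_smul_measure,
    lintegral_map hφ (by fun_prop), lintegral_map hφ (by fun_prop), smul_eq_mul, smul_eq_mul]

lemma mul_lintegral_mixMeasure_le (hρ : ρ ∈ Ioo (0 : ℝ) 1)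
    (hg : Measurable (Function.uncurry g)) {ι : ℝ} (hgι : ∀ x X, g x X ∈ Icc ι (1 - ι))
    {ψ : Ed d → ℝ≥0∞} (hψ : Measurable ψ) (x : Ed d) :
    ENNReal.ofReal ι * ∫⁻ y, ψ (x + y) ∂(mixMeasure d ρ Γ) ≤
      ∫⁻ y, ψ y ∂(stepLaw d ρ Γ g x) := by
  have m₁ : Measurable fun X => ψ (x + (1 - ρ) • X) := hψ.comp (by fun_prop)
  have m₂ : Measurable fun X => ψ (x + (-ρ) • X) := hψ.comp (by fun_prop)
  rw [lintegral_stepLaw hg hψ, lintegral_mixMeasure (φ := fun y => ψ (x + y))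
    (hψ.comp (by fun_prop)), mul_add, ← mul_assoc, ← mul_assoc, ← lintegral_const_mul _ m₁,
    ← lintegral_const_mul _ m₂, ← lintegral_add_left (m₁.const_mul _)]
  refine lintegral_mono fun X => ?_
  have h1 : ENNReal.ofReal ι * ENNReal.ofReal ρ ≤ ENNReal.ofReal (g x X) := by
    refine (mul_le_of_le_one_right zero_le ?_).trans (ENNReal.ofReal_le_ofReal (hgι x X).1)
    simpa using hρ.2.le
  have h2 : ENNReal.ofReal ι * ENNReal.ofReal (1 - ρ) ≤ ENNReal.ofReal (1 - g x X) := by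
    refine (mul_le_of_le_one_right zero_le ?_).trans
      (ENNReal.ofReal_le_ofReal (by linarith [(hgι x X).2]))
    simpa using hρ.1.le
  rw [neg_smul, ← sub_eq_add_neg]
  gcongr

lemma integrable_stepLaw [IsProbabilityMeasure Γ] (hg : Measurable (Function.uncurry g))
    (hg01 : ∀ x X, g x X ∈ Icc (0 : ℝ) 1) {φ : Ed d → ℝ} (hφ : Measurable φ) {x : Ed d}
    {b : Ed d → ℝ} (hb : Integrable b Γ) (h₁ : ∀ X, |φ (x + (1 - ρ) • X)| ≤ b X)
    (h₂ : ∀ X, |φ (x - ρ • X)| ≤ b X) : Integrable φ (stepLaw d ρ Γ g x) := by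
  refine ⟨hφ.aestronglyMeasurable, ?_⟩
  rw [hasFiniteIntegral_iff_norm, lintegral_stepLaw hg hφ.norm.ennreal_ofReal]
  have hfin : ∫⁻ X, ENNReal.ofReal (b X) ∂Γ < ⊤ := hb.lintegral_lt_top
  refine lt_of_le_of_lt (lintegral_mono fun X => ?_) hfin
  calc _ ≤ ENNReal.ofReal (g x X) * ENNReal.ofReal (b X) +
        ENNReal.ofReal (1 - g x X) * ENNReal.ofReal (b X) := by
        gcongr
        · exact h₁ X
        · exact h₂ X
    _ = ENNReal.ofReal (b X) := by
        rw [← add_mul, ← ENNReal.ofReal_add (hg01 x X).1 (by linarith [(hg01 x X).2])]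
        simp

end Kernel

section Drift

variable {d : ℕ}

lemma exp_le_one_add_add_sq_mul_exp_abs (s : ℝ) :
    Real.exp s ≤ 1 + s + s ^ 2 * Real.exp |s| := by
  rcases le_or_gt |s| 1 with h | h
  · have h1 := (abs_le.1 (Real.abs_exp_sub_one_sub_id_le h)).2
    have h2 : s ^ 2 * 1 ≤ s ^ 2 * Real.exp |s| :=
      mul_le_mul_of_nonneg_left (Real.one_le_exp (abs_nonneg s)) (sq_nonneg s)
    linarith
  · rcases lt_abs.1 h with h | h
    · rw [abs_of_pos (by linarith)]
      have h2 : 1 * Real.exp s ≤ s ^ 2 * Real.exp s :=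
        mul_le_mul_of_nonneg_right (by nlinarith) (Real.exp_pos s).le
      linarith
    · have h1 : Real.exp s ≤ 1 := Real.exp_le_one_iff.2 (by linarith)
      have h2 : s ^ 2 * 1 ≤ s ^ 2 * Real.exp |s| :=
        mul_le_mul_of_nonneg_left (Real.one_le_exp (abs_nonneg s)) (sq_nonneg s)
      nlinarith

lemma norm_add_le_add_inner_div {x : Ed d} (hx : 0 < ‖x‖) (y : Ed d) :
    ‖x + y‖ ≤ ‖x‖ + ⟪y, x⟫ / ‖x‖ + ‖y‖ ^ 2 / (2 * ‖x‖) := by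
  have h1 := norm_add_sq_real x y
  rw [real_inner_comm] at h1
  have e : ‖x‖ + ⟪y, x⟫ / ‖x‖ + ‖y‖ ^ 2 / (2 * ‖x‖) = (‖x‖ ^ 2 + ‖x + y‖ ^ 2) / (2 * ‖x‖) := by
    rw [h1]
    field_simp
    ring
  rw [e, le_div_iff₀ (by positivity)]
  nlinarith [sq_nonneg (‖x‖ - ‖x + y‖)]

lemma exp_norm_add_smul_le {lam l : ℝ} (hlam : 0 < lam) (hl : lam ≤ l / 2) {a : ℝ}
    (ha : |a| ≤ 1) {x : Ed d} (hx : 0 < ‖x‖) (y : Ed d) :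
    Real.exp (lam * ‖x + a • y‖) ≤ Real.exp (lam * ‖x‖) *
      (1 + lam * (a * (⟪y, x⟫ / ‖x‖)) +
        lam * (1 / (2 * ‖x‖) + lam) * (‖y‖ ^ 2 * Real.exp (l / 2 * ‖y‖))) := by
  have hay : ‖a • y‖ ≤ ‖y‖ := by
    rw [norm_smul, Real.norm_eq_abs]
    exact mul_le_of_le_one_left (norm_nonneg _) ha
  have hl2 : 0 ≤ l / 2 := hlam.le.trans hl
  have hay2 : ‖a • y‖ ^ 2 ≤ ‖y‖ ^ 2 := by gcongr
  set s := ‖x + a • y‖ - ‖x‖ with hs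
  have hs1 : |s| ≤ ‖y‖ := by
    have := abs_norm_sub_norm_le (x + a • y) x
    rw [add_sub_cancel_left] at this
    exact this.trans hay
  have hs2 : s ≤ a * (⟪y, x⟫ / ‖x‖) + 1 / (2 * ‖x‖) * ‖y‖ ^ 2 := by
    have h1 := norm_add_le_add_inner_div hx (a • y)
    rw [real_inner_smul_left, mul_div_assoc] at h1
    have h2 : ‖a • y‖ ^ 2 / (2 * ‖x‖) ≤ 1 / (2 * ‖x‖) * ‖y‖ ^ 2 := by
      rw [one_div_mul_eq_div]
      gcongr
    linarith
  have e : lam * ‖x + a • y‖ = lam * ‖x‖ + lam * s := by rw [hs]; ring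
  rw [e, Real.exp_add]
  refine mul_le_mul_of_nonneg_left ?_ (Real.exp_pos _).le
  refine (exp_le_one_add_add_sq_mul_exp_abs _).trans ?_
  have h3 : ‖y‖ ^ 2 ≤ ‖y‖ ^ 2 * Real.exp (l / 2 * ‖y‖) :=
    le_mul_of_one_le_right (sq_nonneg _) (Real.one_le_exp (by positivity))
  have h4 : (lam * s) ^ 2 * Real.exp |lam * s| ≤
      lam ^ 2 * (‖y‖ ^ 2 * Real.exp (l / 2 * ‖y‖)) := by
    rw [mul_pow, mul_assoc, ← sq_abs s]
    have h5 : |lam * s| ≤ l / 2 * ‖y‖ := by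
      rw [abs_mul, abs_of_pos hlam]
      gcongr
    gcongr
  have h6 : lam * (1 / (2 * ‖x‖) * ‖y‖ ^ 2) ≤
      lam * (1 / (2 * ‖x‖) * (‖y‖ ^ 2 * Real.exp (l / 2 * ‖y‖))) := by gcongr
  have h7 : lam * s ≤ lam * (a * (⟪y, x⟫ / ‖x‖) + 1 / (2 * ‖x‖) * ‖y‖ ^ 2) := by gcongr
  nlinarith

variable {ρ : ℝ} {Γ : Measure (Ed d)}

lemma integrable_sq_mul_exp {l : ℝ} (hl : 0 < l)
    (hintg : Integrable (fun x => Real.exp (l * ‖x‖)) Γ) :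
    Integrable (fun x => ‖x‖ ^ 2 * Real.exp (l / 2 * ‖x‖)) Γ := by
  refine (hintg.const_mul (8 / l ^ 2)).mono' (by fun_prop) (ae_of_all _ fun x => ?_)
  rw [Real.norm_of_nonneg (by positivity)]
  have h1 := Real.quadratic_le_exp_of_nonneg (x := l / 2 * ‖x‖) (by positivity)
  have h2 : ‖x‖ ^ 2 ≤ 8 / l ^ 2 * Real.exp (l / 2 * ‖x‖) := by
    rw [div_mul_eq_mul_div, le_div_iff₀ (by positivity)]
    have : 0 ≤ l / 2 * ‖x‖ := by positivity
    nlinarith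
  have e : Real.exp (l * ‖x‖) = Real.exp (l / 2 * ‖x‖) * Real.exp (l / 2 * ‖x‖) := by
    rw [← Real.exp_add]
    ring_nf
  rw [e, ← mul_assoc]
  gcongr

lemma kernelOp_exp_norm_le_of_large {lam l G M Δ : ℝ} {g : Ed d → Ed d → ℝ}
    [IsProbabilityMeasure Γ] (hρ : ρ ∈ Ioo (0 : ℝ) 1) (hlam : 0 < lam) (hl : lam ≤ l / 2)
    (hq : Integrable (fun x => ‖x‖ ^ 2 * Real.exp (l / 2 * ‖x‖)) Γ)
    (hG : ∫ x, ‖x‖ ^ 2 * Real.exp (l / 2 * ‖x‖) ∂Γ ≤ G) (hG0 : 0 < G) (hΔ : 0 < Δ)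
    (hlG : lam ≤ Δ / (4 * G)) (hg : Measurable (Function.uncurry g))
    (hg01 : ∀ x X, g x X ∈ Icc (0 : ℝ) 1)
    (hneg : ∀ x : Ed d, M ≤ ‖x‖ → (∫ X, (g x X - ρ) * (⟪X, x⟫ / ‖x‖) ∂Γ) ≤ -Δ)
    {x : Ed d} (hM : M ≤ ‖x‖) (hx : 2 * G / Δ ≤ ‖x‖) :
    kernelOp d ρ Γ g (fun y => Real.exp (lam * ‖y‖)) x ≤
      (1 - lam * Δ / 2) * Real.exp (lam * ‖x‖) := by
  have hx0 : 0 < ‖x‖ := lt_of_lt_of_le (by positivity) hx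
  have hgx : Measurable (g x) := hg.of_uncurry_left
  have hnorm : Integrable (fun X : Ed d => ‖X‖) Γ := by
    refine ((integrable_const 1).add hq).mono' (by fun_prop) (ae_of_all _ fun X => ?_)
    have h3 : ‖X‖ ^ 2 ≤ ‖X‖ ^ 2 * Real.exp (l / 2 * ‖X‖) :=
      le_mul_of_one_le_right (sq_nonneg _) (Real.one_le_exp (by
        have := norm_nonneg X
        have : 0 ≤ l / 2 := hlam.le.trans hl
        positivity))
    rw [norm_norm]
    simp only [Pi.add_apply]
    nlinarith [sq_nonneg (‖X‖ - 1)]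
  have hu : Integrable (fun X => (g x X - ρ) * (⟪X, x⟫ / ‖x‖)) Γ := by
    refine hnorm.mono' ?_ (ae_of_all _ fun X => ?_)
    · have m : Measurable fun X : Ed d => ⟪X, x⟫ / ‖x‖ := by fun_prop
      exact ((hgx.sub_const ρ).mul m).aestronglyMeasurable
    · rw [norm_mul, Real.norm_eq_abs, Real.norm_eq_abs]
      have h1 : |g x X - ρ| ≤ 1 := by
        rw [abs_le]
        constructor <;> linarith [(hg01 x X).1, (hg01 x X).2, hρ.1, hρ.2]
      have h2 : |⟪X, x⟫ / ‖x‖| ≤ ‖X‖ := by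
        rw [abs_div, abs_norm, div_le_iff₀ hx0]
        exact abs_real_inner_le_norm X x
      calc _ ≤ 1 * ‖X‖ := by gcongr
        _ = ‖X‖ := one_mul _
  set V := Real.exp (lam * ‖x‖) with hV
  set b := lam * (1 / (2 * ‖x‖) + lam) with hb
  have hI₁ : Integrable (fun X => 1 + lam * ((g x X - ρ) * (⟪X, x⟫ / ‖x‖))) Γ :=
    (integrable_const 1).add (hu.const_mul lam)
  have hI : Integrable (fun X => 1 + lam * ((g x X - ρ) * (⟪X, x⟫ / ‖x‖)) +
      b * (‖X‖ ^ 2 * Real.exp (l / 2 * ‖X‖))) Γ :=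
    hI₁.add (hq.const_mul b)
  have h1 : kernelOp d ρ Γ g (fun y => Real.exp (lam * ‖y‖)) x ≤
      ∫ X, V * (1 + lam * ((g x X - ρ) * (⟪X, x⟫ / ‖x‖)) +
        b * (‖X‖ ^ 2 * Real.exp (l / 2 * ‖X‖))) ∂Γ := by
    refine integral_mono_of_nonneg (ae_of_all _ fun X => ?_) (hI.const_mul V)
      (ae_of_all _ fun X => ?_)
    · have := (hg01 x X).1
      have : 0 ≤ 1 - g x X := by linarith [(hg01 x X).2]
      simp only [Pi.zero_apply]
      positivity
    · have a1 := exp_norm_add_smul_le (a := 1 - ρ) hlam hl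
        (by rw [abs_le]; constructor <;> linarith [hρ.1, hρ.2]) hx0 X
      have a2 := exp_norm_add_smul_le (a := -ρ) hlam hl
        (by rw [abs_le]; constructor <;> linarith [hρ.1, hρ.2]) hx0 X
      rw [neg_smul, ← sub_eq_add_neg] at a2
      have c1 := mul_le_mul_of_nonneg_left a1 (hg01 x X).1
      have c2 := mul_le_mul_of_nonneg_left a2 (by linarith [(hg01 x X).2] : 0 ≤ 1 - g x X)
      refine (add_le_add c1 c2).trans (le_of_eq ?_)
      ring
  refine h1.trans ?_
  have hV0 : 0 < V := Real.exp_pos _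
  rw [integral_const_mul, mul_comm]
  refine mul_le_mul_of_nonneg_right ?_ hV0.le
  rw [integral_add hI₁ (hq.const_mul b),
    integral_add (integrable_const 1) (hu.const_mul lam), integral_const_mul,
    integral_const_mul]
  have h2 := hneg x hM
  have hb1 : b * G ≤ lam * (Δ / 2) := by
    rw [hb, mul_assoc]
    refine mul_le_mul_of_nonneg_left ?_ hlam.le
    have h3 : 1 / (2 * ‖x‖) * G ≤ Δ / 4 := by
      rw [one_div_mul_eq_div, div_le_iff₀ (by positivity)]
      rw [div_le_iff₀ hΔ] at hx
      linarith
    have h4 : lam * G ≤ Δ / 4 := by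
      rw [le_div_iff₀ (by positivity)] at hlG
      linarith
    linarith
  have hb2 : b * ∫ x, ‖x‖ ^ 2 * Real.exp (l / 2 * ‖x‖) ∂Γ ≤ b * G := by
    refine mul_le_mul_of_nonneg_left hG ?_
    positivity
  have h5 := mul_le_mul_of_nonneg_left h2 hlam.le
  simp only [integral_const, probReal_univ, smul_eq_mul, one_mul]
  linarith

lemma kernelOp_exp_norm_le_of_small {lam R : ℝ} {g : Ed d → Ed d → ℝ}
    (hρ : ρ ∈ Ioo (0 : ℝ) 1) (hlam : 0 < lam)
    (hintg : Integrable (fun x => Real.exp (lam * ‖x‖)) Γ)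
    (hg01 : ∀ x X, g x X ∈ Icc (0 : ℝ) 1) {x : Ed d} (hx : ‖x‖ ≤ R) :
    kernelOp d ρ Γ g (fun y => Real.exp (lam * ‖y‖)) x ≤
      Real.exp (lam * R) * ∫ X, Real.exp (lam * ‖X‖) ∂Γ := by
  rw [← integral_const_mul]
  refine integral_mono_of_nonneg (ae_of_all _ fun X => ?_) (hintg.const_mul _)
    (ae_of_all _ fun X => ?_)
  · have := (hg01 x X).1
    have : 0 ≤ 1 - g x X := by linarith [(hg01 x X).2]
    simp only [Pi.zero_apply]
    positivity
  · have key : ∀ a : ℝ, |a| ≤ 1 → Real.exp (lam * ‖x + a • X‖) ≤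
        Real.exp (lam * R) * Real.exp (lam * ‖X‖) := fun a ha => by
      rw [← Real.exp_add, Real.exp_le_exp, ← mul_add]
      refine mul_le_mul_of_nonneg_left ((norm_add_le _ _).trans (add_le_add hx ?_)) hlam.le
      rw [norm_smul, Real.norm_eq_abs]
      exact mul_le_of_le_one_left (norm_nonneg _) ha
    have a1 := key (1 - ρ) (by rw [abs_le]; constructor <;> linarith [hρ.1, hρ.2])
    have a2 := key (-ρ) (by rw [abs_le]; constructor <;> linarith [hρ.1, hρ.2])
    rw [neg_smul, ← sub_eq_add_neg] at a2
    have c1 := mul_le_mul_of_nonneg_left a1 (hg01 x X).1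
    have c2 := mul_le_mul_of_nonneg_left a2 (by linarith [(hg01 x X).2] : 0 ≤ 1 - g x X)
    refine (add_le_add c1 c2).trans (le_of_eq ?_)
    ring

lemma exists_drift [IsProbabilityMeasure Γ] (hρ : ρ ∈ Ioo (0 : ℝ) 1) {M Δ : ℝ} (hΔ : 0 < Δ)
    (hsub : SubExp d Γ) :
    ∃ lam > 0, Integrable (fun x => Real.exp (lam * ‖x‖)) Γ ∧ ∃ γ ∈ Ioo (0 : ℝ) 1, ∃ K > 0,
      ∀ g : Ed d → Ed d → ℝ, Measurable (Function.uncurry g) →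
        (∀ x X, g x X ∈ Icc (0 : ℝ) 1) →
        (∀ x : Ed d, M ≤ ‖x‖ → (∫ X, (g x X - ρ) * (⟪X, x⟫ / ‖x‖) ∂Γ) ≤ -Δ) →
        ∀ x, kernelOp d ρ Γ g (fun y => Real.exp (lam * ‖y‖)) x ≤
          γ * Real.exp (lam * ‖x‖) + K := by
  obtain ⟨l, hl, hintg⟩ := hsub
  have hq := integrable_sq_mul_exp hl hintg
  set G := (∫ x, ‖x‖ ^ 2 * Real.exp (l / 2 * ‖x‖) ∂Γ) + 1 with hG
  have hG0 : 0 < G := by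
    have : 0 ≤ ∫ x, ‖x‖ ^ 2 * Real.exp (l / 2 * ‖x‖) ∂Γ :=
      integral_nonneg fun x => by positivity
    linarith
  set lam := min (l / 2) (min (1 / Δ) (Δ / (4 * G))) with hlam
  have hlam0 : 0 < lam := lt_min (by positivity) (lt_min (by positivity) (by positivity))
  have h1 : lam ≤ l / 2 := min_le_left _ _
  have h2 : lam ≤ 1 / Δ := (min_le_right _ _).trans (min_le_left _ _)
  have h3 : lam ≤ Δ / (4 * G) := (min_le_right _ _).trans (min_le_right _ _)
  have hintg' : Integrable (fun x => Real.exp (lam * ‖x‖)) Γ := by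
    refine hintg.mono' (by fun_prop) (ae_of_all _ fun x => ?_)
    rw [Real.norm_of_nonneg (Real.exp_pos _).le]
    gcongr
    linarith
  rw [le_div_iff₀ hΔ] at h2
  have hlΔ : 0 < lam * Δ := by positivity
  refine ⟨lam, hlam0, hintg', 1 - lam * Δ / 2, ⟨by linarith, by linarith⟩,
    Real.exp (lam * max M (2 * G / Δ)) * (∫ X, Real.exp (lam * ‖X‖) ∂Γ) + 1, ?_, ?_⟩
  · have : 0 ≤ ∫ X, Real.exp (lam * ‖X‖) ∂Γ := integral_nonneg fun x => (Real.exp_pos _).le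
    positivity
  intro g hg hg01 hneg x
  have hI0 : 0 ≤ ∫ X, Real.exp (lam * ‖X‖) ∂Γ := integral_nonneg fun x => (Real.exp_pos _).le
  rcases le_total (max M (2 * G / Δ)) ‖x‖ with hx | hx
  · refine (kernelOp_exp_norm_le_of_large hρ hlam0 h1 hq (by linarith) hG0 hΔ h3 hg hg01 hneg
      ((le_max_left _ _).trans hx) ((le_max_right _ _).trans hx)).trans ?_
    have : 0 ≤ Real.exp (lam * max M (2 * G / Δ)) * ∫ X, Real.exp (lam * ‖X‖) ∂Γ := by
      positivity
    linarith
  · refine (kernelOp_exp_norm_le_of_small hρ hlam0 hintg' hg01 hx).trans ?_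
    have : 0 ≤ (1 - lam * Δ / 2) * Real.exp (lam * ‖x‖) :=
      mul_nonneg (by linarith) (Real.exp_pos _).le
    linarith

end Drift

section Chain

variable {d : ℕ} {ρ : ℝ} {Γ : Measure (Ed d)} {g : Ed d → Ed d → ℝ}

lemma kernelOp_eq_kernelAvg_of_bounded [IsProbabilityMeasure Γ]
    (hg : Measurable (Function.uncurry g)) (hg01 : ∀ x X, g x X ∈ Icc (0 : ℝ) 1)
    {φ : Ed d → ℝ} (hφ : Measurable φ) {B : ℝ} (hB : ∀ x, |φ x| ≤ B) :
    kernelOp d ρ Γ g φ = kernelAvg (stepKernel d ρ Γ g hg) φ := by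
  funext x
  exact kernelOp_eq_integral_stepLaw hg hg01 hφ
    (integrable_stepLaw hg hg01 hφ (integrable_const B) (fun _ => hB _) (fun _ => hB _))

lemma iterate_kernelOp_eq_iterate_kernelAvg [IsProbabilityMeasure Γ]
    (hg : Measurable (Function.uncurry g)) (hg01 : ∀ x X, g x X ∈ Icc (0 : ℝ) 1)
    {φ : Ed d → ℝ} (hφ : Measurable φ) {B : ℝ} (hB : ∀ x, |φ x| ≤ B) (n : ℕ) :
    (kernelOp d ρ Γ g)^[n] φ = (kernelAvg (stepKernel d ρ Γ g hg))^[n] φ := by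
  have := isMarkovKernel_stepKernel (d := d) (ρ := ρ) (Γ := Γ) hg hg01
  induction n generalizing φ with
  | zero => rfl
  | succ n ih =>
    rw [Function.iterate_succ_apply, Function.iterate_succ_apply,
      kernelOp_eq_kernelAvg_of_bounded hg hg01 hφ hB,
      ih (measurable_kernelAvg hφ) (abs_kernelAvg_le hB)]

lemma isInvariantMeasure_iff_bind_eq [IsProbabilityMeasure Γ]
    (hg : Measurable (Function.uncurry g)) (hg01 : ∀ x X, g x X ∈ Icc (0 : ℝ) 1)
    (π : Measure (Ed d)) [IsProbabilityMeasure π] :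
    IsInvariantMeasure d ρ Γ g π ↔ π.bind (stepKernel d ρ Γ g hg) = π := by
  have := isMarkovKernel_stepKernel (d := d) (ρ := ρ) (Γ := Γ) hg hg01
  have key : ∀ A : Set (Ed d), MeasurableSet A →
      ∫ x, kernelOp d ρ Γ g (A.indicator fun _ => (1 : ℝ)) x ∂π =
        (π.bind (stepKernel d ρ Γ g hg) A).toReal := fun A hA => by
    have hm : Measurable (A.indicator fun _ => (1 : ℝ)) := measurable_const.indicator hA
    have hb : ∀ x, |A.indicator (fun _ => (1 : ℝ)) x| ≤ 1 := fun x => by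
      by_cases hx : x ∈ A <;> simp [hx]
    rw [kernelOp_eq_kernelAvg_of_bounded hg hg01 hm hb, ← integral_bind_kernel _ _ hm hb,
      integral_indicator_const _ hA]
    simp [Measure.real]
  constructor
  · intro h
    ext A hA
    have h1 := h A hA
    rw [key A hA] at h1
    exact ((ENNReal.toReal_eq_toReal_iff' (measure_ne_top _ _) (measure_ne_top _ _)).1 h1).symm
  · intro h A hA
    rw [key A hA, h]

lemma measurable_shift [SFinite Γ] (hg : Measurable (Function.uncurry g)) {f : Ed d → ℝ}
    (hf : Measurable f) : Measurable fun x => ∫ X, (g x X - ρ) * f X ∂Γ := by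
  have h1 : Measurable fun p : Ed d × Ed d => (g p.1 p.2 - ρ) * f p.2 :=
    (hg.sub_const ρ).mul (hf.comp measurable_snd)
  exact h1.stronglyMeasurable.integral_prod_right'.measurable

lemma abs_shift_le (hρ : ρ ∈ Ioo (0 : ℝ) 1) (hg01 : ∀ x X, g x X ∈ Icc (0 : ℝ) 1)
    {f : Ed d → ℝ} (hf : Integrable f Γ) (x : Ed d) :
    |∫ X, (g x X - ρ) * f X ∂Γ| ≤ ∫ X, |f X| ∂Γ := by
  refine (abs_integral_le_integral_abs).trans ?_
  refine integral_mono_of_nonneg (ae_of_all _ fun X => abs_nonneg _) hf.abs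
    (ae_of_all _ fun X => ?_)
  have h1 : |g x X - ρ| ≤ 1 := by
    rw [abs_le]
    constructor <;> linarith [(hg01 x X).1, (hg01 x X).2, hρ.1, hρ.2]
  simp only [abs_mul]
  exact mul_le_of_le_one_left (abs_nonneg _) h1

lemma abs_sum_sub_le_of_geometric {a : ℕ → ℝ} {b C r : ℝ} (hC : 0 ≤ C) (hr : r ∈ Ioo (0 : ℝ) 1)
    (h : ∀ n, |a n - b| ≤ C * r ^ n) (n : ℕ) :
    |∑ i ∈ Finset.range n, a i - n * b| ≤ C / (1 - r) := by
  have e : ∑ i ∈ Finset.range n, a i - n * b = ∑ i ∈ Finset.range n, (a i - b) := by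
    simp [Finset.sum_sub_distrib]
  rw [e]
  calc _ ≤ ∑ i ∈ Finset.range n, |a i - b| := Finset.abs_sum_le_sum_abs _ _
    _ ≤ ∑ i ∈ Finset.range n, C * r ^ i := Finset.sum_le_sum fun i _ => h i
    _ = C * ∑ i ∈ Finset.range n, r ^ i := by rw [Finset.mul_sum]
    _ ≤ C * (1 - r)⁻¹ := by
        refine mul_le_mul_of_nonneg_left ?_ hC
        rw [← tsum_geometric_of_lt_one hr.1.le hr.2]
        exact (summable_geometric_of_lt_one hr.1.le hr.2).sum_le_tsum _
          fun i _ => pow_nonneg hr.1.le i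
    _ = _ := (div_eq_mul_inv _ _).symm

end Chain

/-- Under sub-exponential `Γ`, spread-out `Γ_ρ` and the `(M,Δ)`-negative feedback condition,
the kernel `P_g` has a unique invariant probability `π_g`, and uniformly over such `g`, the
expected shift `Σ_{i=1}^n (P_g^{i−1}h)(Λ)` differs from `n·π_g(h)` by at most
`L²·(∫|f|dΓ)·exp(λ₁‖Λ‖)`, where `h(Λ) = ∫ (g(Λ,X)−ρ)f(X) dΓ(X)`. -/
theorem stmt7 (d : ℕ) (ρ ι M Δ : ℝ) (hρ : ρ ∈ Set.Ioo (0 : ℝ) 1)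
    (hι : ι ∈ Set.Ioo (0 : ℝ) (1 / 2)) (hM : 0 < M) (hΔ : 0 < Δ)
    (Γ : Measure (Ed d)) [IsProbabilityMeasure Γ]
    (hsub : SubExp d Γ) (hso : SpreadOut d (mixMeasure d ρ Γ)) :
    ∃ lam₁ > (0 : ℝ), ∃ L > (1 : ℝ),
      ∀ g : Ed d → Ed d → ℝ, Measurable (Function.uncurry g) →
        (∀ Λ X, g Λ X ∈ Set.Icc ι (1 - ι)) →
        NegFeedback d ρ M Δ Γ g →
        ∃ π : Measure (Ed d), IsProbabilityMeasure π ∧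
          IsInvariantMeasure d ρ Γ g π ∧
          (∀ π' : Measure (Ed d), IsProbabilityMeasure π' →
            IsInvariantMeasure d ρ Γ g π' → π' = π) ∧
          ∀ f : Ed d → ℝ, Measurable f → Integrable f Γ →
            ∀ n : ℕ, 1 ≤ n → ∀ Λ : Ed d,
              |(∑ i ∈ Finset.range n,
                  (kernelOp d ρ Γ g)^[i]
                    (fun Λ' => ∫ X, (g Λ' X - ρ) * f X ∂Γ) Λ) -
                n * ∫ Λ', (∫ X, (g Λ' X - ρ) * f X ∂Γ) ∂π|
              ≤ L ^ 2 * (∫ X, |f X| ∂Γ) * Real.exp (lam₁ * ‖Λ‖) := by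
  have hμ := isProbabilityMeasure_mixMeasure (d := d) (Γ := Γ) hρ
  have htop := suppSpan_eq_top hρ hso
  obtain ⟨lam, hlam, hintg, γ, hγ, K, hK, hdrift⟩ := exists_drift (M := M) hρ hΔ hsub
  set V : Ed d → ℝ := fun x => Real.exp (lam * ‖x‖) with hV
  have hVc : Continuous V := by fun_prop
  have hV1 : ∀ x, 1 ≤ V x := fun x => Real.one_le_exp (by positivity)
  have hγ1 : 0 < 1 - γ := by linarith [hγ.2]
  set R : ℝ := 4 * (K / (1 - γ)) / (1 - γ) with hR
  have hR0 : 0 < R := by positivity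
  have hR1 : 0 < R / lam := by positivity
  obtain ⟨N, hN, hdom⟩ := exists_dominatesBall_zero_of_radius hρ hso (2 * (R / lam))
  obtain ⟨ε, hε, hminor⟩ := exists_minorization_const (ι := ι)
    ⟨hι.1, by linarith [hι.2]⟩ hR1 hdom
  have hν := isProbabilityMeasure_unifBall (d := d) hR1
  obtain ⟨C, hC, r, hr, hdecay⟩ := exists_geometric_decay (Ed d) hVc.measurable hV1 hγ hK hε hN
    (R := R) (by rw [hR, mul_div_cancel₀ _ hγ1.ne']) (unifBall d (R / lam))
    (integrable_unifBall hR1 hVc)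
  have hr1 : 0 < 1 - r := by linarith [hr.2]
  have hγ0 := hγ.1
  set D : ℝ := C * (γ + K + 1) / (1 - r) / (1 - r) with hD
  have hD0 : 0 < D := by positivity
  refine ⟨lam, hlam, 1 + D, by linarith, fun g hg hgι hneg => ?_⟩
  have hg01 : ∀ x X, g x X ∈ Icc (0 : ℝ) 1 := fun x X =>
    ⟨hι.1.le.trans (hgι x X).1, by linarith [(hgι x X).2, hι.1]⟩
  have hκ := isMarkovKernel_stepKernel (d := d) (ρ := ρ) (Γ := Γ) hg hg01
  set κ := stepKernel d ρ Γ g hg with hκdef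
  have hI : ∀ x, Integrable V (κ x) := fun x => by
    have key : ∀ a : ℝ, |a| ≤ 1 → ∀ X : Ed d, |V (x + a • X)| ≤ V x * V X := fun a ha X => by
      rw [abs_of_pos (Real.exp_pos _), hV]
      simp only
      rw [← Real.exp_add, Real.exp_le_exp, ← mul_add]
      refine mul_le_mul_of_nonneg_left ((norm_add_le _ _).trans (add_le_add le_rfl ?_)) hlam.le
      rw [norm_smul, Real.norm_eq_abs]
      exact mul_le_of_le_one_left (norm_nonneg _) ha
    refine integrable_stepLaw hg hg01 hVc.measurable (hintg.const_mul (V x)) (key _ ?_)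
      fun X => ?_
    · rw [abs_le]
      constructor <;> linarith [hρ.1, hρ.2]
    · rw [sub_eq_add_neg, ← neg_smul]
      refine key _ ?_ X
      rw [abs_le]
      constructor <;> linarith [hρ.1, hρ.2]
  have hop : IsDriftOp V γ K (kernelAvg κ) := isDriftOp_kernelAvg hV1 hI hK.le fun x => by
    refine le_trans (le_of_eq ?_)
      (hdrift g hg hg01 (fun y hy => hneg y (htop ▸ Submodule.mem_top) hy) x)
    exact (kernelOp_eq_integral_stepLaw hg hg01 hVc.measurable (hI x)).symm
  have hdec := hdecay (kernelAvg κ) hop fun φ hφ hφ0 x hx => by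
    refine hminor κ (fun ψ hψ y => mul_lintegral_mixMeasure_le hρ hg hgι hψ y) hVc hop hI φ hφ
      hφ0 x ?_
    rw [le_div_iff₀ hlam]
    have := Real.add_one_le_exp (lam * ‖x‖)
    have hx' : Real.exp (lam * ‖x‖) ≤ R := hx
    linarith
  obtain ⟨π, hπ, hinv, huniq, hconv⟩ := exists_unique_invariant hVc.measurable hV1 hop hK.le
    hC.le hr hdec
  refine ⟨π, hπ, (isInvariantMeasure_iff_bind_eq hg hg01 π).2 hinv, fun π' hπ' h' =>
    huniq π' hπ' ((isInvariantMeasure_iff_bind_eq hg hg01 π').1 h'), ?_⟩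
  intro f hf hfi n _ x
  set h : Ed d → ℝ := fun x => ∫ X, (g x X - ρ) * f X ∂Γ with hh
  have hm : Measurable h := measurable_shift hg hf
  have hb : ∀ x, |h x| ≤ ∫ X, |f X| ∂Γ := abs_shift_le hρ hg01 hfi
  have hB0 : 0 ≤ ∫ X, |f X| ∂Γ := integral_nonneg fun X => abs_nonneg _
  set B := ∫ X, |f X| ∂Γ with hB
  have hVx : 0 < V x := Real.exp_pos _
  have h1 : ∀ i, |(kernelOp d ρ Γ g)^[i] h x - ∫ y, h y ∂π| ≤
      (B * C * ((γ + K + 1) * V x)) / (1 - r) * r ^ i := fun i => by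
    rw [iterate_kernelOp_eq_iterate_kernelAvg hg hg01 hm hb i]
    refine (hconv h B hm hb i x).trans (le_of_eq ?_)
    ring
  refine (abs_sum_sub_le_of_geometric (by positivity) hr h1 n).trans ?_
  have e : B * C * ((γ + K + 1) * V x) / (1 - r) / (1 - r) = D * B * V x := by
    rw [hD]
    ring
  rw [e]
  have hL : D ≤ (1 + D) ^ 2 := by nlinarith
  change D * B * V x ≤ (1 + D) ^ 2 * B * V x
  gcongr
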